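/- Let d ≥ 1, p ∈ [1, 3), β ∈ (0, 2], L > 0 and c > 0, and set b_n = c · n^{−2/(d+2β)}. Then the Dirichlet kernel density estimators satisfy limsup_{n→∞} [ sup_{f ∈ Σ(d,β,L)} (E_f ‖f̂_{n,b_n} − f‖_p^p)^{1/p} ] / n^{−β/(d+2β)} < ∞; i.e., the estimator achieves the minimax rate n^{−β/(d+2β)} on Σ(d,β,L) under the L^p loss. -/

import Mathlib

open MeasureTheory Filter Topology
open scoped ENNReal BigOperators

noncomputable section

/-- The d-dimensional simplex `S_d = {s ∈ [0,1]^d : s_1 + ⋯ + s_d ≤ 1}`. -/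
def Sd (d : ℕ) : Set (Fin d → ℝ) :=
  {s | (∀ i, 0 ≤ s i ∧ s i ≤ 1) ∧ ∑ i, s i ≤ 1}

/-- The Dirichlet density `K_{u,v}` on `S_d` (0 outside). -/
def dirK (d : ℕ) (u : Fin d → ℝ) (v : ℝ) : (Fin d → ℝ) → ℝ :=
  Set.indicator (Sd d)
    (fun s => Real.Gamma (v + ∑ i, u i) / (Real.Gamma v * ∏ i, Real.Gamma (u i)) *
      (1 - ∑ i, s i) ^ (v - 1) * ∏ i, (s i) ^ (u i - 1))

/-- The Dirichlet kernel `K_{s/b+1, (1-‖s‖₁)/b+1}` at location `s` with bandwidth `b`. -/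
def dirKb (d : ℕ) (b : ℝ) (s : Fin d → ℝ) : (Fin d → ℝ) → ℝ :=
  dirK d (fun i => s i / b + 1) ((1 - ∑ i, s i) / b + 1)

/-- The Dirichlet kernel density estimator based on the sample `X`. -/
def fhat (d n : ℕ) (b : ℝ) (X : Fin n → Fin d → ℝ) (s : Fin d → ℝ) : ℝ :=
  (n : ℝ)⁻¹ * ∑ i, dirKb d b s (X i)

/-- `m` = the largest integer strictly less than `β` (for `β > 0`). -/
def mOf (β : ℝ) : ℕ := ⌈β⌉₊ - 1

/-- Partial derivative of order `j` in the directions `v` (on the interior of the simplex). -/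
def Dpartial (d j : ℕ) (f : (Fin d → ℝ) → ℝ) (v : Fin j → Fin d) (s : Fin d → ℝ) : ℝ :=
  iteratedFDerivWithin ℝ j f (interior (Sd d)) s fun i => Pi.single (v i) 1

/-- The Hölder class `Σ(d, β, L)` of probability densities supported on `S_d`. -/
def holderClass (d : ℕ) (β L : ℝ) : Set ((Fin d → ℝ) → ℝ) :=
  {f | (∀ s, 0 ≤ f s) ∧ (∀ s, s ∉ Sd d → f s = 0) ∧ (∫ s in Sd d, f s) = 1 ∧
    ContDiffOn ℝ (mOf β) f (interior (Sd d)) ∧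
    ∀ v : Fin (mOf β) → Fin d, ∀ s ∈ interior (Sd d), ∀ t ∈ interior (Sd d),
      |Dpartial d (mOf β) f v s - Dpartial d (mOf β) f v t| ≤
        L * (∑ i, |s i - t i|) ^ (β - (mOf β : ℝ))}

/-- `E_f ‖f̂_{n,b} − f‖_p^p`: expectation, under i.i.d. sampling of `X_1, …, X_n` from the
density `f`, of the `p`-th power of the `L^p` distance between `f̂_{n,b}` and `f` on `S_d`. -/
def lpRiskPow (d n : ℕ) (b p : ℝ) (f : (Fin d → ℝ) → ℝ) : ℝ :=
  ∫ ω : Fin n → Fin d → ℝ,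
    (∏ i, f (ω i)) * ∫ s in Sd d, |fhat d n b ω s - f s| ^ p

lemma beta_lint_one {a c : ℝ} (ha : 0 < a) (hc : 0 < c) :
    ∫⁻ x in Set.Ioo (0:ℝ) 1, ENNReal.ofReal (x ^ (a - 1) * (1 - x) ^ (c - 1)) =
      ENNReal.ofReal (ProbabilityTheory.beta a c) := by
  have h := ProbabilityTheory.lintegral_betaPDF_eq_one ha hc
  rw [ProbabilityTheory.lintegral_betaPDF] at h
  have hb := ProbabilityTheory.beta_pos ha hc
  have h2 : ∀ x : ℝ, ENNReal.ofReal (1 / ProbabilityTheory.beta a c * x ^ (a - 1) * (1 - x) ^ (c - 1))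
      = ENNReal.ofReal (1 / ProbabilityTheory.beta a c) * ENNReal.ofReal (x ^ (a - 1) * (1 - x) ^ (c - 1)) := by
    intro x
    rw [← ENNReal.ofReal_mul (by positivity), mul_assoc]
  simp_rw [h2] at h
  rw [lintegral_const_mul' _ _ ENNReal.ofReal_ne_top] at h
  calc _ = ENNReal.ofReal (ProbabilityTheory.beta a c) * (ENNReal.ofReal (1 / ProbabilityTheory.beta a c) * ∫⁻ x in Set.Ioo (0:ℝ) 1, ENNReal.ofReal (x ^ (a - 1) * (1 - x) ^ (c - 1))) := by
        rw [← mul_assoc, ← ENNReal.ofReal_mul hb.le, mul_one_div_cancel hb.ne']; simp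
    _ = _ := by rw [h, mul_one]

lemma beta_lint {a c r : ℝ} (ha : 0 < a) (hc : 0 < c) (hr : 0 < r) :
    ∫⁻ x in Set.Ioo (0:ℝ) r, ENNReal.ofReal (x ^ (a - 1) * (r - x) ^ (c - 1)) =
      ENNReal.ofReal (ProbabilityTheory.beta a c * r ^ (a + c - 1)) := by
  have him : (fun x : ℝ => r * x) '' Set.Ioo 0 1 = Set.Ioo 0 r := by
    rw [Set.image_mul_left_Ioo hr]; simp
  rw [← him, lintegral_image_eq_lintegral_abs_deriv_mul (f' := fun _ => r) measurableSet_Ioo]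
  · have : ∀ x ∈ Set.Ioo (0:ℝ) 1, ENNReal.ofReal |r| * ENNReal.ofReal ((r * x) ^ (a - 1) * (r - r * x) ^ (c - 1))
        = ENNReal.ofReal (r ^ (a + c - 1)) * ENNReal.ofReal (x ^ (a - 1) * (1 - x) ^ (c - 1)) := by
      intro x hx
      rw [← ENNReal.ofReal_mul (abs_nonneg _), ← ENNReal.ofReal_mul (by positivity)]
      congr 1
      have h1 : r - r * x = r * (1 - x) := by ring
      have : r ^ (a + c - 1) = r * r ^ (a - 1) * r ^ (c - 1) := by
        rw [show a + c - 1 = 1 + (a - 1) + (c - 1) by ring, Real.rpow_add hr, Real.rpow_add hr,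
          Real.rpow_one]
      rw [h1, Real.mul_rpow hr.le hx.1.le, Real.mul_rpow hr.le (by linarith [hx.2]), abs_of_pos hr, this]
      ring
    rw [setLIntegral_congr_fun measurableSet_Ioo this, lintegral_const_mul' _ _ ENNReal.ofReal_ne_top,
      beta_lint_one ha hc, ← ENNReal.ofReal_mul (by positivity), mul_comm]
  · intro x _
    simpa using ((hasDerivAt_id x).const_mul r).hasDerivWithinAt
  · intro x _ y _ h
    exact mul_left_cancel₀ hr.ne' h

/-- open simplex of size r -/
def So (d : ℕ) (r : ℝ) : Set (Fin d → ℝ) := {s | (∀ i, 0 < s i) ∧ ∑ i, s i < r}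

lemma isOpen_So (d : ℕ) (r : ℝ) : IsOpen (So d r) := by
  have : So d r = (⋂ i, {s | 0 < s i}) ∩ {s | ∑ i, s i < r} := by
    ext s; simp [So]
  rw [this]
  refine IsOpen.inter (isOpen_iInter_of_finite fun i => ?_) ?_
  · exact isOpen_lt continuous_const (continuous_apply i)
  · exact isOpen_lt (by fun_prop) continuous_const

lemma measurableSet_So (d : ℕ) (r : ℝ) : MeasurableSet (So d r) := (isOpen_So d r).measurableSet

lemma dir_lint (d : ℕ) : ∀ (r : ℝ) (u : Fin d → ℝ) (v : ℝ), 0 < r → (∀ i, 0 < u i) → 0 < v →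
    ∫⁻ s in So d r, ENNReal.ofReal ((r - ∑ i, s i) ^ (v - 1) * ∏ i, (s i) ^ (u i - 1)) =
      ENNReal.ofReal (Real.Gamma v * (∏ i, Real.Gamma (u i)) / Real.Gamma (v + ∑ i, u i) *
        r ^ (v + ∑ i, u i - 1)) := by
  induction d with
  | zero =>
    intro r u v hr hu hv
    have : So 0 r = Set.univ := by
      ext s; simp [So, hr]
    have hG := (Real.Gamma_pos_of_pos hv).ne'
    rw [this]
    have hvol : volume (Set.univ : Set (Fin 0 → ℝ)) = 1 := by
      rw [volume_pi, Measure.pi_of_empty]; simp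
    simp [hG, hvol]
  | succ d ih =>
    intro r u v hr hu hv
    have hms := measurableSet_So (d+1) r
    have hm1 : Measurable (fun s : Fin (d+1) → ℝ => ENNReal.ofReal ((r - ∑ i, s i) ^ (v - 1) * ∏ i, (s i) ^ (u i - 1))) := by
      fun_prop
    rw [← lintegral_indicator hms]
    set F : (Fin (d+1) → ℝ) → ℝ≥0∞ := (So (d+1) r).indicator (fun s : Fin (d+1) → ℝ => ENNReal.ofReal ((r - ∑ i, s i) ^ (v - 1) * ∏ i, (s i) ^ (u i - 1))) with hF
    have hFm : Measurable F := hm1.indicator hms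
    have hmp := (volume_preserving_piFinSuccAbove (fun _ : Fin (d+1) => ℝ) 0).symm
    rw [← hmp.lintegral_comp_emb (MeasurableEquiv.measurableEmbedding _), Measure.volume_eq_prod,
      lintegral_prod (fun a : ℝ × (Fin d → ℝ) => F ((MeasurableEquiv.piFinSuccAbove (fun _ : Fin (d+1) => ℝ) 0).symm a))
        (hFm.comp (MeasurableEquiv.measurable _)).aemeasurable]
    set W : ℝ := v + ∑ i : Fin d, u i.succ with hW
    have hWpos : 0 < W := add_pos_of_pos_of_nonneg hv (Finset.sum_nonneg fun i _ => (hu _).le)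
    set C : ℝ := Real.Gamma v * (∏ i : Fin d, Real.Gamma (u i.succ)) / Real.Gamma W with hC
    have hCpos : 0 ≤ C := by
      have := Real.Gamma_pos_of_pos hv
      have := Real.Gamma_pos_of_pos hWpos
      have := Finset.prod_pos (s := Finset.univ) (f := fun i : Fin d => Real.Gamma (u i.succ)) (fun i _ => Real.Gamma_pos_of_pos (hu _))
      positivity
    have key : ∀ x : ℝ, ∫⁻ y : Fin d → ℝ, F ((MeasurableEquiv.piFinSuccAbove (fun _ : Fin (d+1) => ℝ) 0).symm (x, y))
        = (Set.Ioo 0 r).indicator (fun x => ENNReal.ofReal C * ENNReal.ofReal (x ^ (u 0 - 1) * (r - x) ^ (W - 1))) x := by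
      intro x
      have hcons : ∀ y : Fin d → ℝ, (MeasurableEquiv.piFinSuccAbove (fun _ : Fin (d+1) => ℝ) 0).symm (x, y) = Fin.cons x y := by
        intro y
        rw [MeasurableEquiv.piFinSuccAbove_symm_apply]
        simp [Fin.insertNthEquiv, Fin.insertNth_zero]
      simp_rw [hcons]
      by_cases hx : x ∈ Set.Ioo 0 r
      · rw [Set.indicator_of_mem hx]
        have h1 : ∀ y : Fin d → ℝ, F (Fin.cons x y) = ENNReal.ofReal (x ^ (u 0 - 1)) * (So d (r - x)).indicator (fun y => ENNReal.ofReal ((r - x - ∑ i, y i) ^ (v - 1) * ∏ i : Fin d, (y i) ^ (u i.succ - 1))) y := by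
          intro y
          have hmem : (Fin.cons x y : Fin (d+1) → ℝ) ∈ So (d+1) r ↔ y ∈ So d (r - x) := by
            simp only [So, Set.mem_ofPred_eq, Fin.forall_fin_succ, Fin.sum_univ_succ, Fin.cons_zero, Fin.cons_succ]
            constructor
            · rintro ⟨⟨_, h⟩, h2⟩; exact ⟨h, by linarith⟩
            · rintro ⟨h, h2⟩; exact ⟨⟨hx.1, h⟩, by linarith⟩
          by_cases hy : y ∈ So d (r - x)
          · rw [hF, Set.indicator_of_mem (hmem.2 hy), Set.indicator_of_mem hy,
              ← ENNReal.ofReal_mul (Real.rpow_nonneg hx.1.le _)]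
            congr 1
            simp only [Fin.sum_univ_succ, Fin.prod_univ_succ, Fin.cons_zero, Fin.cons_succ]
            rw [← sub_sub]; ring
          · rw [hF, Set.indicator_of_notMem (fun h => hy (hmem.1 h)), Set.indicator_of_notMem hy, mul_zero]
        simp_rw [h1]
        rw [lintegral_const_mul' _ _ ENNReal.ofReal_ne_top, lintegral_indicator (measurableSet_So _ _),
          ih (r - x) (fun i => u i.succ) v (by linarith [hx.2]) (fun i => hu _) hv,
          ← ENNReal.ofReal_mul (Real.rpow_nonneg hx.1.le _), ← ENNReal.ofReal_mul hCpos]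
        congr 1
        ring
      · rw [Set.indicator_of_notMem hx]
        have : ∀ y : Fin d → ℝ, F (Fin.cons x y) = 0 := by
          intro y
          rw [hF, Set.indicator_of_notMem]
          intro h
          apply hx
          simp only [So, Set.mem_ofPred_eq, Fin.forall_fin_succ, Fin.sum_univ_succ, Fin.cons_zero, Fin.cons_succ] at h
          refine ⟨h.1.1, ?_⟩
          have := Finset.sum_nonneg (s := Finset.univ) (f := y) (fun i _ => (h.1.2 i).le)
          linarith [h.2]
        simp [this]
    simp_rw [key]
    rw [lintegral_indicator measurableSet_Ioo, lintegral_const_mul' _ _ ENNReal.ofReal_ne_top,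
      beta_lint (hu 0) hWpos hr, ← ENNReal.ofReal_mul hCpos]
    congr 1
    rw [ProbabilityTheory.beta, hC, Fin.prod_univ_succ, Fin.sum_univ_succ]
    have e1 : u 0 + W = v + (u 0 + ∑ i : Fin d, u i.succ) := by rw [hW]; ring
    rw [e1]
    have := (Real.Gamma_pos_of_pos hWpos).ne'
    field_simp

lemma So_subset_Sd (d : ℕ) : So d 1 ⊆ Sd d := by
  intro s hs
  refine ⟨fun i => ⟨(hs.1 i).le, ?_⟩, hs.2.le⟩
  have := Finset.single_le_sum (f := s) (fun j _ => (hs.1 j).le) (Finset.mem_univ i)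
  linarith [hs.2]

lemma convex_Sd (d : ℕ) : Convex ℝ (Sd d) := by
  intro x hx y hy a b ha hb hab
  refine ⟨fun i => ?_, ?_⟩
  · have h1 := hx.1 i
    have h2 := hy.1 i
    simp only [Pi.add_apply, Pi.smul_apply, smul_eq_mul]
    constructor
    · have := h1.1; have := h2.1; positivity
    · nlinarith
  · simp only [Pi.add_apply, Pi.smul_apply, smul_eq_mul, Finset.sum_add_distrib, ← Finset.mul_sum]
    nlinarith [hx.2, hy.2]

lemma interior_Sd (d : ℕ) : interior (Sd d) = So d 1 := by
  apply Set.Subset.antisymm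
  · intro s hs
    rw [mem_interior_iff_mem_nhds, Metric.mem_nhds_iff] at hs
    obtain ⟨ε, hε, hb⟩ := hs
    have key : ∀ i (δ : ℝ), |δ| < ε → Function.update s i (s i + δ) ∈ Sd d := by
      intro i δ hδ
      apply hb
      rw [Metric.mem_ball, dist_pi_lt_iff hε]
      intro j
      by_cases hj : j = i
      · subst hj; simpa [Real.dist_eq] using hδ
      · simpa [Function.update_of_ne hj] using hε
    refine ⟨fun i => ?_, ?_⟩
    · have := ((key i (-(ε/2)) (by rw [abs_neg, abs_of_pos] <;> linarith)).1 i).1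
      simp at this
      linarith
    · rcases Nat.eq_zero_or_pos d with h | h
      · subst h; simp
      · have := (key ⟨0, h⟩ (ε/2) (by rw [abs_of_pos] <;> linarith)).2
        rw [Finset.sum_update_of_mem (Finset.mem_univ _)] at this
        have h2 := Finset.add_sum_erase Finset.univ s (Finset.mem_univ (⟨0, h⟩ : Fin d))
        rw [Finset.sdiff_singleton_eq_erase] at this
        linarith
  · exact interior_maximal (So_subset_Sd d) (isOpen_So d 1)

lemma So_ae_eq (d : ℕ) : So d 1 =ᵐ[volume] Sd d := by
  rw [← interior_Sd]
  exact interior_ae_eq_of_null_frontier ((convex_Sd d).addHaar_frontier volume)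

lemma restrict_Sd (d : ℕ) : (volume.restrict (Sd d) : Measure (Fin d → ℝ)) = volume.restrict (So d 1) :=
  Measure.restrict_congr_set (So_ae_eq d).symm

lemma isClosed_Sd (d : ℕ) : IsClosed (Sd d) := by
  have : Sd d = (⋂ i, {s | 0 ≤ s i ∧ s i ≤ 1}) ∩ {s | ∑ i, s i ≤ 1} := by
    ext s; simp [Sd]
  rw [this]
  refine IsClosed.inter (isClosed_iInter fun i => ?_) ?_
  · exact (isClosed_le continuous_const (continuous_apply i)).inter (isClosed_le (continuous_apply i) continuous_const)
  · exact isClosed_le (by fun_prop) continuous_const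

lemma measurableSet_Sd (d : ℕ) : MeasurableSet (Sd d) := (isClosed_Sd d).measurableSet

lemma volume_Sd_lt_top (d : ℕ) : volume (Sd d) < ⊤ := by
  refine lt_of_le_of_lt (measure_mono (t := Set.Icc (0 : Fin d → ℝ) 1) ?_) ?_
  · intro s hs
    exact ⟨fun i => (hs.1 i).1, fun i => (hs.1 i).2⟩
  · exact isCompact_Icc.measure_lt_top

lemma dirK_nonneg (d : ℕ) {u : Fin d → ℝ} {v : ℝ} (hu : ∀ i, 0 < u i) (hv : 0 < v) (x : Fin d → ℝ) :
    0 ≤ dirK d u v x := by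
  apply Set.indicator_nonneg
  intro s hs
  have h1 := Real.Gamma_pos_of_pos hv
  have h2 : 0 < Real.Gamma (v + ∑ i, u i) :=
    Real.Gamma_pos_of_pos (add_pos_of_pos_of_nonneg hv (Finset.sum_nonneg fun i _ => (hu _).le))
  have h3 := Finset.prod_pos (s := Finset.univ) (f := fun i : Fin d => Real.Gamma (u i)) (fun i _ => Real.Gamma_pos_of_pos (hu _))
  have h4 : 0 ≤ (1 - ∑ i, s i) ^ (v - 1) := Real.rpow_nonneg (by linarith [hs.2]) _
  have h5 : 0 ≤ ∏ i, (s i) ^ (u i - 1) := Finset.prod_nonneg fun i _ => Real.rpow_nonneg (hs.1 i).1 _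
  positivity

lemma measurable_dirK (d : ℕ) (u : Fin d → ℝ) (v : ℝ) : Measurable (dirK d u v) := by
  apply Measurable.indicator _ (measurableSet_Sd d)
  fun_prop

lemma lintegral_dirK (d : ℕ) {u : Fin d → ℝ} {v : ℝ} (hu : ∀ i, 0 < u i) (hv : 0 < v) :
    ∫⁻ x, ENNReal.ofReal (dirK d u v x) = 1 := by
  have h1 := Real.Gamma_pos_of_pos hv
  have h2 : 0 < Real.Gamma (v + ∑ i, u i) :=
    Real.Gamma_pos_of_pos (add_pos_of_pos_of_nonneg hv (Finset.sum_nonneg fun i _ => (hu _).le))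
  have h3 := Finset.prod_pos (s := Finset.univ) (f := fun i : Fin d => Real.Gamma (u i)) (fun i _ => Real.Gamma_pos_of_pos (hu _))
  have e : ∀ x, ENNReal.ofReal (dirK d u v x) = (Sd d).indicator (fun s =>
     ENNReal.ofReal (Real.Gamma (v + ∑ i, u i) / (Real.Gamma v * ∏ i, Real.Gamma (u i))) *
      ENNReal.ofReal ((1 - ∑ i, s i) ^ (v - 1) * ∏ i, (s i) ^ (u i - 1))) x := by
    intro x
    by_cases hx : x ∈ Sd d
    · rw [dirK, Set.indicator_of_mem hx, Set.indicator_of_mem hx, ← ENNReal.ofReal_mul (by positivity), mul_assoc]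
    · rw [dirK, Set.indicator_of_notMem hx, Set.indicator_of_notMem hx, ENNReal.ofReal_zero]
  simp_rw [e]
  rw [lintegral_indicator (measurableSet_Sd d), restrict_Sd, lintegral_const_mul' _ _ ENNReal.ofReal_ne_top,
    dir_lint d 1 u v one_pos hu hv, ← ENNReal.ofReal_mul (by positivity), Real.one_rpow,
    ← ENNReal.ofReal_one]
  congr 1
  field_simp

lemma integrable_dirK (d : ℕ) {u : Fin d → ℝ} {v : ℝ} (hu : ∀ i, 0 < u i) (hv : 0 < v) :
    Integrable (dirK d u v) := by
  refine ⟨(measurable_dirK d u v).aestronglyMeasurable, ?_⟩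
  rw [hasFiniteIntegral_iff_ofReal (ae_of_all _ (dirK_nonneg d hu hv)), lintegral_dirK d hu hv]
  simp

lemma integral_dirK (d : ℕ) {u : Fin d → ℝ} {v : ℝ} (hu : ∀ i, 0 < u i) (hv : 0 < v) :
    ∫ x, dirK d u v x = 1 := by
  rw [integral_eq_lintegral_of_nonneg_ae (ae_of_all _ (dirK_nonneg d hu hv))
    (measurable_dirK d u v).aestronglyMeasurable, lintegral_dirK d hu hv]
  simp

lemma dirK_mul (d : ℕ) {u : Fin d → ℝ} {v : ℝ} (hu : ∀ i, 0 < u i) (hv : 0 < v) (i : Fin d) (x : Fin d → ℝ) :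
    dirK d u v x * x i = u i / (v + ∑ j, u j) * dirK d (Function.update u i (u i + 1)) v x := by
  by_cases hx : x ∈ Sd d
  swap
  · simp [dirK, Set.indicator_of_notMem hx]
  have hN : 0 < v + ∑ j, u j := add_pos_of_pos_of_nonneg hv (Finset.sum_nonneg fun i _ => (hu _).le)
  have h1 := Real.Gamma_pos_of_pos hv
  have h2 := Real.Gamma_pos_of_pos hN
  have h3 := fun i => Real.Gamma_pos_of_pos (hu i)
  have hsum : v + ∑ j, Function.update u i (u i + 1) j = (v + ∑ j, u j) + 1 := by
    rw [Finset.sum_update_of_mem (Finset.mem_univ _), Finset.sdiff_singleton_eq_erase]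
    have := Finset.add_sum_erase Finset.univ u (Finset.mem_univ i)
    linarith
  rw [dirK, dirK, Set.indicator_of_mem hx, Set.indicator_of_mem hx, hsum, Real.Gamma_add_one hN.ne']
  rw [← Finset.mul_prod_erase Finset.univ (fun j => Real.Gamma (u j)) (Finset.mem_univ i),
    ← Finset.mul_prod_erase Finset.univ (fun j => Real.Gamma (Function.update u i (u i + 1) j)) (Finset.mem_univ i),
    ← Finset.mul_prod_erase Finset.univ (fun j => x j ^ (u j - 1)) (Finset.mem_univ i),
    ← Finset.mul_prod_erase Finset.univ (fun j => x j ^ (Function.update u i (u i + 1) j - 1)) (Finset.mem_univ i)]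
  have e1 : ∏ j ∈ Finset.univ.erase i, Real.Gamma (Function.update u i (u i + 1) j) = ∏ j ∈ Finset.univ.erase i, Real.Gamma (u j) :=
    Finset.prod_congr rfl fun j hj => by rw [Function.update_of_ne (Finset.ne_of_mem_erase hj)]
  have e2 : ∏ j ∈ Finset.univ.erase i, x j ^ (Function.update u i (u i + 1) j - 1) = ∏ j ∈ Finset.univ.erase i, x j ^ (u j - 1) :=
    Finset.prod_congr rfl fun j hj => by rw [Function.update_of_ne (Finset.ne_of_mem_erase hj)]
  rw [e1, e2, Function.update_self, Real.Gamma_add_one (hu i).ne']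
  have e3 : x i ^ (u i + 1 - 1) = x i ^ (u i - 1) * x i := by
    rw [← Real.rpow_add_one' (hx.1 i).1 (by linarith [hu i])]; congr 1; ring
  rw [e3]
  have h4 : 0 < ∏ j ∈ Finset.univ.erase i, Real.Gamma (u j) := Finset.prod_pos fun j _ => h3 j
  have := (h3 i).ne'
  have := (hu i).ne'
  field_simp

lemma integral_dirK_mul (d : ℕ) {u : Fin d → ℝ} {v : ℝ} (hu : ∀ i, 0 < u i) (hv : 0 < v) (i : Fin d) :
    Integrable (fun x => dirK d u v x * x i) ∧ ∫ x, dirK d u v x * x i = u i / (v + ∑ j, u j) := by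
  have hu' : ∀ j, 0 < Function.update u i (u i + 1) j := by
    intro j
    by_cases h : j = i
    · subst h; simp; linarith [hu j]
    · rw [Function.update_of_ne h]; exact hu j
  simp_rw [dirK_mul d hu hv i]
  refine ⟨(integrable_dirK d hu' hv).const_mul _, ?_⟩
  rw [integral_const_mul, integral_dirK d hu' hv, mul_one]

lemma integral_dirK_sq (d : ℕ) {u : Fin d → ℝ} {v : ℝ} (hu : ∀ i, 0 < u i) (hv : 0 < v) (i : Fin d) :
    Integrable (fun x => dirK d u v x * x i * x i) ∧
    ∫ x, dirK d u v x * x i * x i = u i * (u i + 1) / ((v + ∑ j, u j) * (v + ∑ j, u j + 1)) := by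
  have hu' : ∀ j, 0 < Function.update u i (u i + 1) j := by
    intro j
    by_cases h : j = i
    · subst h; simp; linarith [hu j]
    · rw [Function.update_of_ne h]; exact hu j
  have hsum : v + ∑ j, Function.update u i (u i + 1) j = (v + ∑ j, u j) + 1 := by
    rw [Finset.sum_update_of_mem (Finset.mem_univ _), Finset.sdiff_singleton_eq_erase]
    have := Finset.add_sum_erase Finset.univ u (Finset.mem_univ i)
    linarith
  have h := integral_dirK_mul d hu' hv i
  rw [hsum, Function.update_self] at h
  simp_rw [dirK_mul d hu hv i, mul_assoc]
  refine ⟨h.1.const_mul _, ?_⟩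
  rw [integral_const_mul, h.2]
  field_simp

section kb
variable {d : ℕ} {b : ℝ} {s : Fin d → ℝ}

lemma kb_pos (hb : 0 < b) (hs : s ∈ Sd d) : (∀ i, 0 < s i / b + 1) ∧ 0 < (1 - ∑ i, s i) / b + 1 := by
  refine ⟨fun i => ?_, ?_⟩
  · have := (hs.1 i).1; positivity
  · have : 0 ≤ 1 - ∑ i, s i := by linarith [hs.2]
    positivity

lemma kb_sum : (1 - ∑ i, s i) / b + 1 + ∑ i, (s i / b + 1) = 1 / b + (d + 1) := by
  rw [Finset.sum_add_distrib, ← Finset.sum_div]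
  simp
  ring

lemma dirKb_nonneg (hb : 0 < b) (hs : s ∈ Sd d) (x : Fin d → ℝ) : 0 ≤ dirKb d b s x :=
  dirK_nonneg d (kb_pos hb hs).1 (kb_pos hb hs).2 x

lemma integrable_dirKb (hb : 0 < b) (hs : s ∈ Sd d) : Integrable (dirKb d b s) :=
  integrable_dirK d (kb_pos hb hs).1 (kb_pos hb hs).2

lemma integral_dirKb (hb : 0 < b) (hs : s ∈ Sd d) : ∫ x, dirKb d b s x = 1 :=
  integral_dirK d (kb_pos hb hs).1 (kb_pos hb hs).2

lemma dirKb_mean (hb : 0 < b) (hs : s ∈ Sd d) (i : Fin d) :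
    Integrable (fun x => dirKb d b s x * (x i - s i)) ∧
    |∫ x, dirKb d b s x * (x i - s i)| ≤ (d + 2) * b := by
  have h := integral_dirK_mul d (kb_pos hb hs).1 (kb_pos hb hs).2 i
  rw [show dirK d (fun i => s i / b + 1) ((1 - ∑ i, s i) / b + 1) = dirKb d b s from rfl] at h
  have h0 := integrable_dirKb hb hs
  have e : ∀ x, dirKb d b s x * (x i - s i) = dirKb d b s x * x i - dirKb d b s x * s i := fun x => by ring
  simp_rw [e]
  refine ⟨h.1.sub (h0.mul_const _), ?_⟩
  rw [integral_sub h.1 (h0.mul_const _), integral_mul_const, integral_dirKb hb hs]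
  have h2 := h.2
  rw [kb_sum] at h2
  rw [h2]
  have hs0 := (hs.1 i).1
  have hs1 := (hs.1 i).2
  have hd : (0:ℝ) ≤ d := Nat.cast_nonneg d
  have : (s i / b + 1) / (1 / b + (d + 1)) - 1 * s i = (1 - (d+1) * s i) * b / (1 + b * (d + 1)) := by
    field_simp; ring
  rw [this, abs_div, abs_mul, abs_of_pos hb, abs_of_pos (show 0 < 1 + b * (d + 1:ℝ) by positivity)]
  rw [div_le_iff₀ (by positivity)]
  have h3 : |1 - ((d:ℝ)+1) * s i| ≤ d + 2 := by
    rw [abs_le]; constructor <;> nlinarith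
  calc |1 - ((d:ℝ)+1) * s i| * b ≤ (d + 2) * b := by gcongr
    _ ≤ (d + 2) * b * (1 + b * (d + 1)) := le_mul_of_one_le_right (by positivity) (by nlinarith)

lemma dirKb_var (hb : 0 < b) (hb1 : b ≤ 1) (hs : s ∈ Sd d) (i : Fin d) :
    Integrable (fun x => dirKb d b s x * (x i - s i) ^ 2) ∧
    ∫ x, dirKb d b s x * (x i - s i) ^ 2 ≤ ((d + 1) ^ 2 + (d + 1) + 3) * b := by
  have h := integral_dirK_mul d (kb_pos hb hs).1 (kb_pos hb hs).2 i
  rw [show dirK d (fun i => s i / b + 1) ((1 - ∑ i, s i) / b + 1) = dirKb d b s from rfl] at h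
  have h' := integral_dirK_sq d (kb_pos hb hs).1 (kb_pos hb hs).2 i
  rw [show dirK d (fun i => s i / b + 1) ((1 - ∑ i, s i) / b + 1) = dirKb d b s from rfl] at h'
  have h0 := integrable_dirKb hb hs
  have e : ∀ x, dirKb d b s x * (x i - s i) ^ 2 = dirKb d b s x * x i * x i - dirKb d b s x * x i * (2 * s i) + dirKb d b s x * s i ^ 2 := fun x => by ring
  simp_rw [e]
  have hi1 : Integrable (fun x => dirKb d b s x * x i * x i - dirKb d b s x * x i * (2 * s i)) := h'.1.sub (h.1.mul_const _)
  refine ⟨hi1.add (h0.mul_const _), ?_⟩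
  rw [integral_add hi1 (h0.mul_const _), integral_sub h'.1 (h.1.mul_const _), integral_mul_const,
    integral_mul_const, integral_dirKb hb hs]
  have h2 := h.2
  have h2' := h'.2
  rw [kb_sum] at h2 h2'
  rw [h2, h2']
  have hs0 := (hs.1 i).1
  have hs1 := (hs.1 i).2
  have hd : (0:ℝ) ≤ d := Nat.cast_nonneg d
  obtain ⟨z, hz⟩ : ∃ z, z = 1 / b := ⟨_, rfl⟩
  have hz1 : 1 ≤ z := by rw [hz]; exact (one_le_div hb).2 hb1
  have hbz : b = 1 / z := by rw [hz]; field_simp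
  have hsb : s i / b = z * s i := by rw [hz]; field_simp
  rw [← hz, hsb, hbz]
  generalize s i = t at *
  set D : ℝ := (d:ℝ) + 1 with hD
  have hN : 0 < z + D := by positivity
  have : (z * t + 1) * (z * t + 1 + 1) / ((z + D) * (z + D + 1)) - (z * t + 1) / (z + D) * (2 * t) + 1 * t ^ 2
     = (z * t * (1 - t) + t ^ 2 * (D ^ 2 + D) + 2 - 2 * t * (D + 1)) / ((z + D) * (z + D + 1)) := by
    field_simp; ring
  rw [this, mul_one_div, div_le_div_iff₀ (by positivity) (by positivity)]
  have hA : z * t * (1 - t) + t ^ 2 * (D ^ 2 + D) + 2 - 2 * t * (D + 1) ≤ z * (D ^ 2 + D + 3) := by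
    have a1 : z * t * (1 - t) ≤ z := by nlinarith [mul_nonneg (show 0 ≤ z by linarith) hs0]
    have hDn : 0 ≤ D := by positivity
    have a2 : t ^ 2 * (D ^ 2 + D) ≤ z * (D ^ 2 + D) := by
      apply mul_le_mul_of_nonneg_right _ (by positivity); nlinarith
    have a3 : 0 ≤ 2 * t * (D + 1) := by positivity
    nlinarith
  calc _ ≤ z * (D ^ 2 + D + 3) * z := mul_le_mul_of_nonneg_right hA (by linarith)
    _ = (D ^ 2 + D + 3) * (z * z) := by ring
    _ ≤ _ := by
      have hDn : 0 ≤ D := by positivity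
      gcongr
      · linarith
      · linarith
end kb

lemma gamma_lower {t : ℝ} (ht : 0 < t) :
    Real.exp (-1/2) * √t * t ^ t * Real.exp (-t) ≤ Real.Gamma (t + 1) := by
  rw [Real.Gamma_eq_integral (by linarith)]
  have hconv := Real.GammaIntegral_convergent (s := t + 1) (by linarith)
  have hst : 0 < √t := Real.sqrt_pos.2 ht
  have hsub : Set.Ioc t (t + √t) ⊆ Set.Ioi 0 := fun x hx => lt_trans ht hx.1
  calc _ = ∫ x in Set.Ioc t (t + √t), Real.exp (-1/2) * t ^ t * Real.exp (-t) := by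
        rw [setIntegral_const]
        simp [measureReal_def, hst.le]
        ring
    _ ≤ ∫ x in Set.Ioc t (t + √t), Real.exp (-x) * x ^ (t + 1 - 1) := by
        apply setIntegral_mono_on _ (hconv.mono_set hsub) measurableSet_Ioc
        · intro x hx
          have hx0 : 0 < x := lt_trans ht hx.1
          rw [add_sub_cancel_right]
          obtain ⟨w, hw⟩ : ∃ w, w = x / t - 1 := ⟨_, rfl⟩
          have hxw : x = t * (1 + w) := by rw [hw]; field_simp; ring
          have hw0 : 0 ≤ w := by
            rw [hw, sub_nonneg, one_le_div ht]; exact hx.1.le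
          have hlog : w - w ^ 2 / 2 ≤ Real.log (1 + w) := by
            refine le_trans ?_ (Real.le_log_one_add_of_nonneg hw0)
            rw [le_div_iff₀ (by linarith)]
            nlinarith [pow_nonneg hw0 3]
          have htw : t * w ^ 2 ≤ 1 := by
            have h1 : t * w ≤ √t := by nlinarith [hx.2]
            have h2 : (t * w) ^ 2 ≤ t := by
              calc (t * w) ^ 2 ≤ √t ^ 2 := by gcongr
                _ = t := Real.sq_sqrt ht.le
            have : t * (t * w ^ 2) ≤ t * 1 := by nlinarith
            exact le_of_mul_le_mul_left this ht
          rw [Real.rpow_def_of_pos hx0, Real.rpow_def_of_pos ht, ← Real.exp_add, ← Real.exp_add, ← Real.exp_add,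
            Real.exp_le_exp, hxw, Real.log_mul ht.ne' (by linarith)]
          nlinarith
        · exact integrableOn_const (by simp)
    _ ≤ _ := by
        apply setIntegral_mono_set hconv _ (LE.le.eventuallyLE hsub)
        filter_upwards [ae_restrict_mem measurableSet_Ioi] with x hx
        exact mul_nonneg (Real.exp_pos _).le (Real.rpow_nonneg (le_of_lt hx) _)

lemma factorial_upper {n : ℕ} (hn : 1 ≤ n) :
    (n.factorial : ℝ) ≤ Real.exp 1 * √n * ((n : ℝ) ^ n * Real.exp (-n)) := by
  obtain ⟨m, rfl⟩ : ∃ m, n = m + 1 := ⟨n - 1, by omega⟩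
  have h := Stirling.stirlingSeq'_antitone (Nat.zero_le m)
  simp only [Function.comp, Nat.succ_eq_add_one, zero_add, Stirling.stirlingSeq_one] at h
  rw [Stirling.stirlingSeq] at h
  rw [div_le_iff₀ (by positivity)] at h
  refine h.trans (le_of_eq ?_)
  have h2 : (0:ℝ) < √2 := by positivity
  have : √(2 * ((m + 1 : ℕ) : ℝ)) = √2 * √((m + 1 : ℕ) : ℝ) := by
    rw [Real.sqrt_mul (by norm_num)]
  rw [this, div_pow, Real.exp_neg, ← Real.exp_nat_mul, mul_one]
  field_simp

lemma gamma_upper {z : ℝ} (hz : 1 ≤ z) :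
    Real.Gamma (z + 1) ≤ 2 * Real.exp 2 * √z * z ^ z * Real.exp (-z) := by
  set n := ⌊z⌋₊ with hn
  have hn1 : 1 ≤ n := by rw [hn]; exact Nat.le_floor (by simpa using hz)
  have hnz : (n:ℝ) ≤ z := Nat.floor_le (by linarith)
  have hzn : z < n + 1 := Nat.lt_floor_add_one z
  obtain ⟨θ, hθ⟩ : ∃ θ, θ = z - n := ⟨_, rfl⟩
  have hθ0 : 0 ≤ θ := by linarith
  have hθ1 : θ < 1 := by linarith
  have hn1' : (1:ℝ) ≤ n := by exact_mod_cast hn1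
  have hfac : 0 < (n.factorial : ℝ) := by exact_mod_cast n.factorial_pos
  have key : Real.Gamma (z + 1) ≤ n.factorial * (n + 1 : ℝ) ^ θ := by
    rcases hθ0.eq_or_lt with h | h
    · have : z = n := by linarith
      rw [← h, this, Real.Gamma_nat_eq_factorial]; simp
    · have := Real.Gamma_mul_add_mul_le_rpow_Gamma_mul_rpow_Gamma (s := n + 1) (t := n + 2) (a := 1 - θ) (b := θ)
        (by positivity) (by positivity) (by linarith) h (by ring)
      have e : (1 - θ) * ((n:ℝ) + 1) + θ * (n + 2) = z + 1 := by rw [hθ]; ring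
      have e2 : Real.Gamma ((n:ℝ) + 2) = n.factorial * (n + 1) := by
        have := Real.Gamma_nat_eq_factorial (n+1)
        push_cast [Nat.factorial_succ] at this
        rw [show (n:ℝ) + 2 = n + 1 + 1 by ring, this]; ring
      rw [e, e2, Real.Gamma_nat_eq_factorial, Real.mul_rpow hfac.le (by positivity), ← mul_assoc, ← Real.rpow_add hfac] at this
      simpa using this
  have hz0 : 0 < z := by linarith
  have hzz : z ^ z = z ^ n * z ^ θ := by
    rw [← Real.rpow_natCast, ← Real.rpow_add hz0]; congr 1; rw [hθ]; ring
  have hez : Real.exp (-n) ≤ Real.exp 1 * Real.exp (-z) := by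
    rw [← Real.exp_add, Real.exp_le_exp]; linarith
  have h2 : (n + 1 : ℝ) ^ θ ≤ 2 * z ^ θ := by
    calc (n + 1 : ℝ) ^ θ ≤ (2 * z) ^ θ := by gcongr; linarith
      _ = 2 ^ θ * z ^ θ := Real.mul_rpow (by norm_num) hz0.le
      _ ≤ 2 ^ (1:ℝ) * z ^ θ := by gcongr; norm_num
      _ = _ := by simp
  calc _ ≤ n.factorial * (n + 1 : ℝ) ^ θ := key
    _ ≤ (Real.exp 1 * √n * ((n : ℝ) ^ n * Real.exp (-n))) * (2 * z ^ θ) := by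
        gcongr; exact factorial_upper hn1
    _ ≤ (Real.exp 1 * √z * (z ^ n * (Real.exp 1 * Real.exp (-z)))) * (2 * z ^ θ) := by gcongr
    _ = _ := by
        rw [hzz, show (2:ℝ) = 1 + 1 by norm_num, Real.exp_add]; ring

lemma gamma_upper_d {z : ℝ} (hz : 1 ≤ z) (k : ℕ) :
    Real.Gamma (z + (k + 1)) ≤ Real.Gamma (z + 1) * ((k + 1) * z) ^ k := by
  induction k with
  | zero => simp
  | succ k ih =>
    have hG : 0 < Real.Gamma (z + 1) := Real.Gamma_pos_of_pos (by linarith)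
    have : z + ((k + 1 : ℕ) + 1 : ℝ) = (z + (k + 1)) + 1 := by push_cast; ring
    rw [this, Real.Gamma_add_one (by positivity)]
    have hk : (0:ℝ) ≤ k := Nat.cast_nonneg k
    push_cast
    calc (z + (k + 1)) * Real.Gamma (z + (k + 1)) ≤ ((k + 1 + 1) * z) * (Real.Gamma (z + 1) * ((k + 1 + 1) * z) ^ k) := by
          have : z + (k + 1) ≤ (k + 1 + 1) * z := by nlinarith
          gcongr
          · refine ih.trans ?_
            gcongr; linarith
      _ = _ := by ring

lemma one_factor {t y z : ℝ} (ht : 0 < t) (hy : 0 ≤ y) (hz : 0 < z) :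
    y ^ (z * t) / Real.Gamma (z * t + 1) ≤
      Real.exp (1/2) * z ^ (-1/2 : ℝ) * t ^ (-1/2 : ℝ) * z ^ (-(z * t)) * Real.exp (z * y) := by
  have hzt : 0 < z * t := by positivity
  have hG := gamma_lower hzt
  have hGp : 0 < Real.Gamma (z * t + 1) := Real.Gamma_pos_of_pos (by linarith)
  have h1 : y ^ (z * t) ≤ t ^ (z * t) * Real.exp (z * (y - t)) := by
    have : y = t * (y / t) := by field_simp
    rw [this, Real.mul_rpow ht.le (by positivity), ← this]
    gcongr
    calc (y / t) ^ (z * t) ≤ (Real.exp (y / t - 1)) ^ (z * t) := by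
          gcongr
          have := Real.add_one_le_exp (y / t - 1)
          linarith
      _ = _ := by
          rw [← Real.exp_mul]; congr 1; field_simp
  rw [div_le_iff₀ hGp]
  refine h1.trans ?_
  refine le_trans (le_of_eq ?_) (mul_le_mul_of_nonneg_left hG (by positivity))
  have e1 : √(z * t) = z ^ (1/2 : ℝ) * t ^ (1/2 : ℝ) := by
    rw [Real.sqrt_eq_rpow, Real.mul_rpow hz.le ht.le]
  rw [e1, Real.mul_rpow hz.le ht.le]
  have e2 : Real.exp (z * (y - t)) = Real.exp (z * y) * Real.exp (-(z * t)) := by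
    rw [← Real.exp_add]; congr 1; ring
  have e3 : Real.exp (1/2) * Real.exp (-1/2) = 1 := by rw [← Real.exp_add]; norm_num
  have e4 : z ^ (-1/2 : ℝ) * z ^ (1/2 : ℝ) = 1 := by rw [← Real.rpow_add hz]; norm_num
  have e5 : t ^ (-1/2 : ℝ) * t ^ (1/2 : ℝ) = 1 := by rw [← Real.rpow_add ht]; norm_num
  have e6 : z ^ (-(z*t)) * z ^ (z * t) = 1 := by rw [← Real.rpow_add hz]; norm_num
  rw [e2]
  calc _ = 1 * 1 * 1 * 1 * (t ^ (z * t) * (Real.exp (z * y) * Real.exp (-(z * t)))) := by ring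
    _ = (Real.exp (1/2) * Real.exp (-1/2)) * (z ^ (-1/2 : ℝ) * z ^ (1/2 : ℝ)) * (t ^ (-1/2 : ℝ) * t ^ (1/2 : ℝ)) * (z ^ (-(z*t)) * z ^ (z * t)) * (t ^ (z * t) * (Real.exp (z * y) * Real.exp (-(z * t)))) := by rw [e3, e4, e5, e6]
    _ = _ := by ring

/-- the singular weight -/
def psi (d : ℕ) (s : Fin d → ℝ) : ℝ := (1 - ∑ i, s i) ^ (-1/2 : ℝ) * ∏ i, (s i) ^ (-1/2 : ℝ)

lemma psi_pos {d : ℕ} {s : Fin d → ℝ} (hs : s ∈ So d 1) : 0 < psi d s := by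
  have h0 : 0 < 1 - ∑ i, s i := by linarith [hs.2]
  exact mul_pos (Real.rpow_pos_of_pos h0 _) (Finset.prod_pos fun i _ => Real.rpow_pos_of_pos (hs.1 i) _)

lemma measurable_psi (d : ℕ) : Measurable (psi d) := by unfold psi; fun_prop

def Csup (d : ℕ) : ℝ := 2 * Real.exp 2 * (d + 1) ^ d * Real.exp (1/2) ^ (d + 1)

lemma Csup_pos (d : ℕ) : 0 < Csup d := by unfold Csup; positivity

lemma dirKb_sup {d : ℕ} {b : ℝ} (hb : 0 < b) (hb1 : b ≤ 1) {s : Fin d → ℝ} (hs : s ∈ So d 1) (x : Fin d → ℝ) :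
    dirKb d b s x ≤ Csup d * b ^ (-(d:ℝ)/2) * psi d s := by
  have hψ := psi_pos hs
  by_cases hx : x ∈ Sd d
  swap
  · rw [dirKb, dirK, Set.indicator_of_notMem hx]
    have := Csup_pos d
    positivity
  obtain ⟨z, hz⟩ : ∃ z, z = 1 / b := ⟨_, rfl⟩
  have hz1 : 1 ≤ z := by rw [hz]; exact (one_le_div hb).2 hb1
  have hz0 : 0 < z := by linarith
  have h0 : 0 < 1 - ∑ i, s i := by linarith [hs.2]
  have hx0 : 0 ≤ 1 - ∑ i, x i := by linarith [hx.2]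
  have hsb : ∀ t, t / b = z * t := fun t => by rw [hz]; field_simp
  rw [dirKb, dirK, Set.indicator_of_mem hx, kb_sum]
  simp only [add_sub_cancel_right, hsb]
  have f0 := one_factor h0 hx0 hz0
  have fi := fun i => one_factor (hs.1 i) (hx.1 i).1 hz0
  have hG0 : 0 < Real.Gamma (z * (1 - ∑ i, s i) + 1) := Real.Gamma_pos_of_pos (by positivity)
  have hGi : ∀ i, 0 < Real.Gamma (z * s i + 1) := fun i => by
    have := hs.1 i
    exact Real.Gamma_pos_of_pos (by positivity)
  have hprod : ∏ i, (x i ^ (z * s i) / Real.Gamma (z * s i + 1)) ≤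
      ∏ i, (Real.exp (1/2) * z ^ (-1/2 : ℝ) * (s i) ^ (-1/2 : ℝ) * z ^ (-(z * s i)) * Real.exp (z * x i)) :=
    Finset.prod_le_prod (fun i _ => div_nonneg (Real.rpow_nonneg (hx.1 i).1 _) (hGi i).le) (fun i _ => fi i)
  have hΓ : Real.Gamma (z + (d + 1)) ≤ 2 * Real.exp 2 * √z * z ^ z * Real.exp (-z) * ((d + 1) * z) ^ d :=
    (gamma_upper_d hz1 d).trans (by gcongr; exact gamma_upper hz1)
  have hΓp : 0 < Real.Gamma (z + (d + 1)) := Real.Gamma_pos_of_pos (by positivity)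
  calc _ = Real.Gamma (z + (d + 1)) * ((1 - ∑ i, x i) ^ (z * (1 - ∑ i, s i)) / Real.Gamma (z * (1 - ∑ i, s i) + 1)
        * ∏ i, (x i ^ (z * s i) / Real.Gamma (z * s i + 1))) := by
        rw [Finset.prod_div_distrib]
        have := (Finset.prod_pos (s := Finset.univ) fun i _ => hGi i).ne'
        field_simp
    _ ≤ (2 * Real.exp 2 * √z * z ^ z * Real.exp (-z) * ((d + 1) * z) ^ d) *
        ((Real.exp (1/2) * z ^ (-1/2 : ℝ) * (1 - ∑ i, s i) ^ (-1/2 : ℝ) * z ^ (-(z * (1 - ∑ i, s i))) * Real.exp (z * (1 - ∑ i, x i))) *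
        ∏ i, (Real.exp (1/2) * z ^ (-1/2 : ℝ) * (s i) ^ (-1/2 : ℝ) * z ^ (-(z * s i)) * Real.exp (z * x i))) := by
        apply mul_le_mul hΓ _ _ (by positivity)
        · apply mul_le_mul f0 hprod
          · exact Finset.prod_nonneg fun i _ => div_nonneg (Real.rpow_nonneg (hx.1 i).1 _) (hGi i).le
          · have := Real.rpow_nonneg h0.le (-1/2)
            positivity
        · apply mul_nonneg
          · exact div_nonneg (Real.rpow_nonneg hx0 _) hG0.le
          · exact Finset.prod_nonneg fun i _ => div_nonneg (Real.rpow_nonneg (hx.1 i).1 _) (hGi i).le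
    _ = _ := by
        simp only [Finset.prod_mul_distrib, Finset.prod_const, Finset.card_univ, Fintype.card_fin]
        rw [← Real.exp_sum, ← Finset.mul_sum, ← Real.rpow_sum_of_pos hz0, Finset.sum_neg_distrib, ← Finset.mul_sum]
        rw [psi]
        generalize (∑ i, s i) = S at *
        have e1 : z ^ z * (z ^ (-(z * (1 - S))) * z ^ (-(z * S))) = 1 := by
          rw [← Real.rpow_add hz0, ← Real.rpow_add hz0, show z + (-(z * (1 - S)) + -(z * S)) = 0 by ring, Real.rpow_zero]
        have e2 : Real.exp (-z) * (Real.exp (z * (1 - ∑ i, x i)) * Real.exp (z * ∑ i, x i)) = 1 := by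
          rw [← Real.exp_add, ← Real.exp_add, show -z + (z * (1 - ∑ i, x i) + z * ∑ i, x i) = 0 by ring, Real.exp_zero]
        have e3 : √z * z ^ d * (z ^ (-1/2:ℝ) * (z ^ (-1/2:ℝ)) ^ d) = b ^ (-(d:ℝ)/2) := by
          have : b = z⁻¹ := by rw [hz]; simp
          rw [this, Real.inv_rpow hz0.le, ← Real.rpow_neg hz0.le, Real.sqrt_eq_rpow, ← Real.rpow_natCast, ← Real.rpow_natCast,
            ← Real.rpow_mul hz0.le, ← Real.rpow_add hz0, ← Real.rpow_add hz0, ← Real.rpow_add hz0]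
          congr 1; ring
        rw [← e3, Csup, mul_pow, pow_succ]
        linear_combination (2 * Real.exp 2 * √z * ((d + 1) ^ d * z ^ d) * (Real.exp (1/2) * z ^ (-1/2 : ℝ) * (1 - S) ^ (-1/2 : ℝ)) * (Real.exp (1/2) ^ d * (z ^ (-1/2 : ℝ)) ^ d * (∏ i, (s i) ^ (-1/2 : ℝ)))) * (e1 * (Real.exp (-z) * (Real.exp (z * (1 - ∑ i, x i)) * Real.exp (z * ∑ i, x i)))  + e2)

lemma convex_So (d : ℕ) : Convex ℝ (So d 1) := by
  rw [← interior_Sd]; exact (convex_Sd d).interior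

lemma l1_le_two {d : ℕ} {s t : Fin d → ℝ} (hs : s ∈ So d 1) (ht : t ∈ So d 1) :
    ∑ i, |t i - s i| ≤ 2 := by
  calc ∑ i, |t i - s i| ≤ ∑ i, (t i + s i) := by
        apply Finset.sum_le_sum; intro i _
        have := hs.1 i; have := ht.1 i
        rw [abs_le]; constructor <;> linarith
    _ = ∑ i, t i + ∑ i, s i := Finset.sum_add_distrib
    _ ≤ 2 := by linarith [hs.2, ht.2]

lemma l1_nonneg {d : ℕ} (s t : Fin d → ℝ) : 0 ≤ ∑ i, |t i - s i| := Finset.sum_nonneg fun _ _ => abs_nonneg _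

lemma clm_sum {d : ℕ} (T : (Fin d → ℝ) →L[ℝ] ℝ) (w : Fin d → ℝ) :
    T w = ∑ i, T (Pi.single i 1) * w i := by
  conv_lhs => rw [pi_eq_sum_univ' w]
  rw [map_sum]
  apply Finset.sum_congr rfl
  intro i _
  rw [map_smul, smul_eq_mul, mul_comm]

lemma holder_taylor {d : ℕ} {β L : ℝ} (hβ1 : 0 < β) (hβ2 : β ≤ 2) (hL : 0 < L)
    {f : (Fin d → ℝ) → ℝ} (hf : f ∈ holderClass d β L) :
    ∃ G : (Fin d → ℝ) → Fin d → ℝ,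
      (∀ s ∈ So d 1, ∀ t ∈ So d 1, ∀ i, |G s i - G t i| ≤ 2 * L) ∧
      ∀ s ∈ So d 1, ∀ t ∈ So d 1, |f t - f s - ∑ i, G s i * (t i - s i)| ≤ L * (∑ i, |t i - s i|) ^ β := by
  obtain ⟨h0, hout, hintg, hcd, hH⟩ := hf
  rw [interior_Sd] at hcd hH
  by_cases hβ : β ≤ 1
  · have hm : mOf β = 0 := by
      have : ⌈β⌉₊ ≤ 1 := Nat.ceil_le.2 (by simpa using hβ)
      unfold mOf; omega
    refine ⟨fun _ _ => 0, fun s _ t _ i => by simpa using hL.le, fun s hs t ht => ?_⟩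
    rw [hm] at hH
    have := hH (fun _ => Fin.elim0 (by assumption)) t ht s hs
    simpa [Dpartial] using this
  · push Not at hβ
    have hm : mOf β = 1 := by
      have h1 : ⌈β⌉₊ ≤ 2 := Nat.ceil_le.2 (by simpa using hβ2)
      have h2 : 1 < ⌈β⌉₊ := Nat.lt_ceil.2 (by simpa using hβ)
      unfold mOf; omega
    rw [hm] at hH hcd
    have hD : ∀ s ∈ So d 1, ∀ t ∈ So d 1, ∀ i, |fderiv ℝ f s (Pi.single i 1) - fderiv ℝ f t (Pi.single i 1)| ≤ L * (∑ i, |s i - t i|) ^ (β - 1) := by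
      intro s hs t ht i
      have := hH (fun _ => i) s hs t ht
      have e : ∀ s ∈ So d 1, Dpartial d 1 f (fun _ => i) s = fderiv ℝ f s (Pi.single i 1) := by
        intro s hs
        rw [Dpartial, interior_Sd, iteratedFDerivWithin_one_apply ((isOpen_So d 1).uniqueDiffWithinAt hs),
          fderivWithin_of_isOpen (isOpen_So d 1) hs]
      rw [e s hs, e t ht] at this
      simpa using this
    refine ⟨fun s i => fderiv ℝ f s (Pi.single i 1), fun s hs t ht i => ?_, fun s hs t ht => ?_⟩
    · refine (hD s hs t ht i).trans ?_
      rw [mul_comm 2 L]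
      gcongr
      have h2 := l1_le_two ht hs
      have h0 := l1_nonneg t s
      calc (∑ i, |s i - t i|) ^ (β - 1) ≤ 2 ^ (β - 1) := Real.rpow_le_rpow h0 h2 (by linarith)
        _ ≤ 2 ^ (1:ℝ) := Real.rpow_le_rpow_of_exponent_le (by norm_num) (by linarith)
        _ = 2 := by simp
    · have hdiff : ∀ x ∈ So d 1, HasFDerivWithinAt f (fderiv ℝ f x) (So d 1) x := fun x hx =>
        ((hcd.differentiableOn (by norm_num)).differentiableAt ((isOpen_So d 1).mem_nhds hx)).hasFDerivAt.hasFDerivWithinAt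
      obtain ⟨z, hz, hzeq⟩ := domain_mvt hdiff (convex_So d) hs ht
      have hzS : z ∈ So d 1 := (convex_So d).segment_subset hs ht hz
      rw [hzeq, clm_sum]
      have hzs : ∑ i, |z i - s i| ≤ ∑ i, |t i - s i| := by
        obtain ⟨θ, hθ, rfl⟩ := (segment_eq_image' ℝ s t ▸ hz : z ∈ (fun θ : ℝ => s + θ • (t - s)) '' Set.Icc 0 1)
        apply Finset.sum_le_sum
        intro i _
        simp only [Pi.add_apply, Pi.smul_apply, Pi.sub_apply, smul_eq_mul, add_sub_cancel_left, abs_mul, abs_of_nonneg hθ.1]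
        exact mul_le_of_le_one_left (abs_nonneg _) hθ.2
      rw [← Finset.sum_sub_distrib]
      calc |∑ i, (fderiv ℝ f z (Pi.single i 1) * (t - s) i - fderiv ℝ f s (Pi.single i 1) * (t i - s i))|
          ≤ ∑ i, |fderiv ℝ f z (Pi.single i 1) * (t - s) i - fderiv ℝ f s (Pi.single i 1) * (t i - s i)| := Finset.abs_sum_le_sum_abs _ _
        _ ≤ ∑ i, L * (∑ i, |t i - s i|) ^ (β - 1) * |t i - s i| := by
            apply Finset.sum_le_sum
            intro i _
            rw [Pi.sub_apply, ← sub_mul, abs_mul]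
            gcongr
            refine (hD z hzS s hs i).trans ?_
            gcongr
        _ = L * ((∑ i, |t i - s i|) ^ (β - 1) * ∑ i, |t i - s i|) := by rw [← Finset.mul_sum]; ring
        _ = _ := by
            rw [← Real.rpow_add_one' (l1_nonneg _ _) (by linarith)]
            congr 2; ring

lemma holder_integrable {d : ℕ} {β L : ℝ} {f : (Fin d → ℝ) → ℝ} (hf : f ∈ holderClass d β L) :
    Integrable f ∧ ∫ x, f x = 1 := by
  obtain ⟨h0, hout, hintg, hcd, hH⟩ := hf
  constructor
  · rw [← integrableOn_iff_integrable_of_support_subset (s := Sd d)]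
    · by_contra h
      rw [integral_undef h] at hintg
      norm_num at hintg
    · intro x hx
      by_contra h
      exact hx (hout x h)
  · rw [← hintg]
    exact (setIntegral_eq_integral_of_forall_compl_eq_zero hout).symm

lemma holder_facts (d : ℕ) (β L : ℝ) (hβ1 : 0 < β) (hβ2 : β ≤ 2) (hL : 0 < L) :
    ∃ M : ℝ, 1 ≤ M ∧ ∀ f ∈ holderClass d β L, ∃ G : (Fin d → ℝ) → Fin d → ℝ,
      (∀ s ∈ So d 1, f s ≤ M) ∧ (∀ s ∈ So d 1, ∀ i, |G s i| ≤ M) ∧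
      ∀ s ∈ So d 1, ∀ t ∈ So d 1, |f t - f s - ∑ i, G s i * (t i - s i)| ≤ M * (∑ i, |t i - s i|) ^ β := by
  obtain ⟨δ, hδ⟩ : ∃ δ : ℝ, δ = 1 / (2 * (d + 1) ^ 2) := ⟨_, rfl⟩
  have hd0 : (0:ℝ) ≤ d := Nat.cast_nonneg d
  have hδ0 : 0 < δ := by rw [hδ]; positivity
  set V : ℝ := (2 * δ) ^ d with hV
  have hV0 : 0 < V := by positivity
  set M0 : ℝ := 1 / V + 4 * L with hM0
  have hM0' : 0 < M0 := by positivity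
  set M1 : ℝ := (M0 + 4 * L) / δ with hM1
  have hM1' : 0 < M1 := by positivity
  set M : ℝ := 1 + (M1 + 2 * L) + (M0 + M1 * 2 + 4 * L) + L with hM
  refine ⟨M, by rw [hM]; linarith, fun f hf => ?_⟩
  obtain ⟨G, hG1, hG2⟩ := holder_taylor hβ1 hβ2 hL hf
  obtain ⟨hfi, hf1⟩ := holder_integrable hf
  have h0 := hf.1
  have hT : ∀ s ∈ So d 1, ∀ t ∈ So d 1, |f t - f s - ∑ i, G s i * (t i - s i)| ≤ 4 * L := by
    intro s hs t ht
    refine (hG2 s hs t ht).trans ?_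
    rw [mul_comm 4 L]
    gcongr
    calc (∑ i, |t i - s i|) ^ β ≤ 2 ^ β := Real.rpow_le_rpow (l1_nonneg _ _) (l1_le_two hs ht) hβ1.le
        _ ≤ 2 ^ (2:ℝ) := Real.rpow_le_rpow_of_exponent_le (by norm_num) hβ2
        _ = 4 := by norm_num
  set s0 : Fin d → ℝ := fun _ => 1 / (d + 1) with hs0
  have hnear : ∀ h : Fin d → ℝ, (∀ i, |h i| ≤ δ) → s0 + h ∈ So d 1 := by
    intro h hh
    have hδ1 : δ < 1 / (d + 1) := by
      rw [hδ]; apply one_div_lt_one_div_of_lt (by positivity); nlinarith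
    constructor
    · intro i
      have := (abs_le.1 (hh i)).1
      simp only [Pi.add_apply, hs0]
      linarith
    · calc ∑ i, (s0 + h) i ≤ ∑ i : Fin d, (1 / (d + 1 : ℝ) + δ) := by
            apply Finset.sum_le_sum; intro i _
            have := (abs_le.1 (hh i)).2
            simp only [Pi.add_apply, hs0]
            linarith
        _ = d * (1 / (d + 1 : ℝ) + δ) := by simp; ring
        _ < 1 := by
            rw [hδ]
            have : (d:ℝ) * (1 / (d + 1) + 1 / (2 * (d + 1) ^ 2)) = (d * (2 * d + 3)) / (2 * (d + 1)^2) := by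
              field_simp; ring
            rw [this, div_lt_one (by positivity)]
            nlinarith
  have hs0S : s0 ∈ So d 1 := by
    have := hnear 0 (by simp [hδ0.le]); simpa using this
  -- value at the centre
  have hf0 : f s0 ≤ M0 := by
    set Q : Set (Fin d → ℝ) := Set.Icc (fun _ => -δ) (fun _ => δ) with hQ
    have hQv : volume.real Q = V := by
      rw [measureReal_def, hQ, Real.volume_Icc_pi_toReal (fun _ => by simp; linarith)]
      simp [hV]; ring_nf
    have hQm : MeasurableSet Q := measurableSet_Icc
    have hQf : volume Q ≠ ⊤ := isCompact_Icc.measure_lt_top.ne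
    have hpt : ∀ h ∈ Q, 2 * (f s0 - 4 * L) ≤ f (s0 + h) + f (s0 - h) := by
      intro h hh
      have hab : ∀ i, |h i| ≤ δ := fun i => abs_le.2 ⟨hh.1 i, hh.2 i⟩
      have a1 := (abs_le.1 (hT s0 hs0S _ (hnear h hab))).1
      have a2 := (abs_le.1 (hT s0 hs0S _ (hnear (-h) (fun i => by simpa using hab i)))).1
      have e1 : ∑ i, G s0 i * ((s0 + h) i - s0 i) = ∑ i, G s0 i * h i := by simp
      have e2 : ∑ i, G s0 i * ((s0 + -h) i - s0 i) = - ∑ i, G s0 i * h i := by simp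
      rw [e1] at a1
      rw [e2] at a2
      rw [← sub_eq_add_neg] at a2
      linarith
    have i1 : Integrable (fun h => f (s0 + h)) := hfi.comp_add_left s0
    have i2 : Integrable (fun h => f (s0 - h)) := hfi.comp_sub_left s0
    have hle : ∫ h in Q, 2 * (f s0 - 4 * L) ≤ ∫ h in Q, (f (s0 + h) + f (s0 - h)) :=
      setIntegral_mono_on (integrableOn_const hQf) (i1.add i2).integrableOn hQm hpt
    have hle2 : ∫ h in Q, (f (s0 + h) + f (s0 - h)) ≤ ∫ h, (f (s0 + h) + f (s0 - h)) :=
      setIntegral_le_integral (i1.add i2) (ae_of_all _ fun h => add_nonneg (h0 _) (h0 _))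
    rw [integral_add i1 i2, integral_add_left_eq_self (μ := volume) f s0, integral_sub_left_eq_self f volume s0, hf1] at hle2
    rw [setIntegral_const, hQv, smul_eq_mul] at hle
    have : V * (f s0 - 4 * L) ≤ 1 := by linarith
    have : f s0 - 4 * L ≤ 1 / V := by rw [le_div_iff₀ hV0]; linarith
    linarith
  have hGs0 : ∀ i, |G s0 i| ≤ M1 := by
    intro i
    have key : ∀ ε : ℝ, |ε| = δ → -(M0 + 4 * L) ≤ G s0 i * ε := by
      intro ε hε
      have hm : s0 + Pi.single i ε ∈ So d 1 := by
        apply hnear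
        intro j
        by_cases hj : j = i
        · subst hj; simp [hε]
        · simp [hj, hδ0.le]
      have a := (abs_le.1 (hT s0 hs0S _ hm)).2
      have e : ∑ j, G s0 j * ((s0 + Pi.single i ε : Fin d → ℝ) j - s0 j) = G s0 i * ε := by
        simp [Pi.single_apply]
      rw [e] at a
      have := h0 (s0 + Pi.single i ε)
      linarith
    have a1 := key δ (abs_of_pos hδ0)
    have a2 := key (-δ) (by rw [abs_neg, abs_of_pos hδ0])
    rw [hM1, abs_le, ← neg_div, div_le_iff₀ hδ0, le_div_iff₀ hδ0]
    constructor <;> linarith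
  refine ⟨G, ?_, ?_, ?_⟩
  · intro s hs
    have a := (abs_le.1 (hT s0 hs0S s hs)).2
    have b : ∑ i, G s0 i * (s i - s0 i) ≤ M1 * 2 := by
      calc ∑ i, G s0 i * (s i - s0 i) ≤ ∑ i, M1 * |s i - s0 i| := by
            apply Finset.sum_le_sum; intro i _
            refine (le_abs_self _).trans ?_
            rw [abs_mul]
            exact mul_le_mul_of_nonneg_right (hGs0 i) (abs_nonneg _)
        _ = M1 * ∑ i, |s i - s0 i| := by rw [Finset.mul_sum]
        _ ≤ M1 * 2 := by gcongr; exact l1_le_two hs0S hs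
    rw [hM]; linarith
  · intro s hs i
    have a := hG1 s hs s0 hs0S i
    have b := hGs0 i
    have : |G s i| ≤ |G s i - G s0 i| + |G s0 i| := by
      have := abs_add_le (G s i - G s0 i) (G s0 i); simpa using this
    rw [hM]; linarith
  · intro s hs t ht
    refine (hG2 s hs t ht).trans ?_
    have := Real.rpow_nonneg (l1_nonneg s t) β
    apply mul_le_mul_of_nonneg_right _ this
    rw [hM]; linarith

lemma rpow_split {r b β : ℝ} (hr : 0 ≤ r) (hb : 0 < b) (hβ1 : 0 < β) (hβ2 : β ≤ 2) :
    r ^ β ≤ b ^ (β/2) + b ^ (β/2 - 1) * r ^ 2 := by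
  rcases le_total (r ^ 2) b with h | h
  · have : r ^ β = (r ^ 2) ^ (β/2) := by
      rw [← Real.rpow_natCast, ← Real.rpow_mul hr]; congr 1; push_cast; ring
    rw [this]
    have h1 : (r ^ 2) ^ (β/2) ≤ b ^ (β/2) := Real.rpow_le_rpow (by positivity) h (by linarith)
    have : 0 ≤ b ^ (β/2 - 1) * r ^ 2 := by positivity
    linarith
  · have hr2 : 0 < r ^ 2 := lt_of_lt_of_le hb h
    have : r ^ β = (r ^ 2) ^ (β/2 - 1) * r ^ 2 := by
      rw [← Real.rpow_add_one hr2.ne', ← Real.rpow_natCast, ← Real.rpow_mul hr]; congr 1; push_cast; ring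
    rw [this]
    have h1 : (r ^ 2) ^ (β/2 - 1) ≤ b ^ (β/2 - 1) := Real.rpow_le_rpow_of_nonpos hb h (by linarith)
    have : 0 ≤ b ^ (β/2) := by positivity
    have := mul_le_mul_of_nonneg_right h1 hr2.le
    linarith

lemma ae_So_or_zero {d : ℕ} (b : ℝ) (s : Fin d → ℝ) :
    ∀ᵐ x, x ∈ So d 1 ∨ (x ∉ Sd d ∧ dirKb d b s x = 0) := by
  filter_upwards [(So_ae_eq d).mem_iff] with x hx
  by_cases h : x ∈ Sd d
  · exact Or.inl (hx.2 h)
  · right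
    refine ⟨h, ?_⟩
    rw [dirKb, dirK, Set.indicator_of_notMem h]

lemma kf_integrable {d : ℕ} {b : ℝ} {s : Fin d → ℝ} (hb : 0 < b) (hs : s ∈ So d 1)
    {f : (Fin d → ℝ) → ℝ} {M : ℝ} (hM : 0 ≤ M) (hf0 : ∀ x, 0 ≤ f x) (hfi : Integrable f)
    (hfM : ∀ s ∈ So d 1, f s ≤ M) :
    Integrable (fun x => dirKb d b s x * f x) ∧ ∫ x, dirKb d b s x * f x ≤ M := by
  have hsS := So_subset_Sd d hs
  have hK := integrable_dirKb hb hsS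
  have hb' : ∀ᵐ x, dirKb d b s x * f x ≤ dirKb d b s x * M := by
    filter_upwards [ae_So_or_zero b s] with x hx
    rcases hx with hx | hx
    · exact mul_le_mul_of_nonneg_left (hfM x hx) (dirKb_nonneg hb hsS x)
    · rw [hx.2]; simp
  have hI : Integrable (fun x => dirKb d b s x * f x) := by
    refine Integrable.mono' (hK.mul_const M) (hK.aestronglyMeasurable.mul hfi.aestronglyMeasurable) ?_
    filter_upwards [hb'] with x hx
    rw [Real.norm_of_nonneg (mul_nonneg (dirKb_nonneg hb hsS x) (hf0 x))]
    exact hx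
  refine ⟨hI, ?_⟩
  calc _ ≤ ∫ x, dirKb d b s x * M := integral_mono_ae hI (hK.mul_const M) hb'
    _ = M := by rw [integral_mul_const, integral_dirKb hb hsS, one_mul]

def Cbias (d : ℕ) (M : ℝ) : ℝ := M * (1 + d * (d * ((d + 1) ^ 2 + (d + 1) + 3))) + d * (M * (d + 2))

lemma Cbias_nonneg (d : ℕ) {M : ℝ} (hM : 0 ≤ M) : 0 ≤ Cbias d M := by unfold Cbias; positivity

lemma bias_bound {d : ℕ} {β b : ℝ} (hβ1 : 0 < β) (hβ2 : β ≤ 2) {s : Fin d → ℝ} (hb : 0 < b) (hb1 : b ≤ 1) (hs : s ∈ So d 1)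
    {f : (Fin d → ℝ) → ℝ} {M : ℝ} (hM : 0 ≤ M) (hf0 : ∀ x, 0 ≤ f x) (hfi : Integrable f)
    (hfM : ∀ s ∈ So d 1, f s ≤ M) {G : (Fin d → ℝ) → Fin d → ℝ} (hG : ∀ s ∈ So d 1, ∀ i, |G s i| ≤ M)
    (hT : ∀ s ∈ So d 1, ∀ t ∈ So d 1, |f t - f s - ∑ i, G s i * (t i - s i)| ≤ M * (∑ i, |t i - s i|) ^ β) :
    |(∫ x, dirKb d b s x * f x) - f s| ≤ Cbias d M * b ^ (β/2) := by
  have hsS := So_subset_Sd d hs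
  have hK := integrable_dirKb hb hsS
  have hKn := dirKb_nonneg hb hsS
  have hKf := (kf_integrable hb hs hM hf0 hfi hfM).1
  have hm := dirKb_mean hb hsS
  have hv := dirKb_var hb hb1 hsS
  set R : (Fin d → ℝ) → ℝ := fun x => f x - f s - ∑ i, G s i * (x i - s i) with hR
  have hlin : Integrable (fun x => ∑ i, G s i * (dirKb d b s x * (x i - s i))) :=
    integrable_finsetSum _ fun i _ => (hm i).1.const_mul _
  have e1 : ∀ x, dirKb d b s x * R x = dirKb d b s x * f x - dirKb d b s x * f s - ∑ i, G s i * (dirKb d b s x * (x i - s i)) := by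
    intro x
    rw [hR]
    simp only [mul_sub, Finset.mul_sum]
    congr 1
    apply Finset.sum_congr rfl; intro i _; ring
  have hi0 : Integrable (fun x => dirKb d b s x * f x - dirKb d b s x * f s) := hKf.sub (hK.mul_const _)
  have hKR : ∫ x, dirKb d b s x * R x = (∫ x, dirKb d b s x * f x) - f s - ∑ i, G s i * ∫ x, dirKb d b s x * (x i - s i) := by
    simp_rw [e1]
    rw [integral_sub hi0 hlin, integral_sub hKf (hK.mul_const _), integral_mul_const, integral_dirKb hb hsS, one_mul,
      integral_finsetSum _ fun i _ => (hm i).1.const_mul _]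
    simp_rw [integral_const_mul]
  have hdom : Integrable (fun x => M * (b ^ (β/2) * dirKb d b s x + b ^ (β/2 - 1) * (d * ∑ i, dirKb d b s x * (x i - s i) ^ 2))) := by
    apply Integrable.const_mul
    apply (hK.const_mul _).add
    apply Integrable.const_mul
    apply Integrable.const_mul
    exact integrable_finsetSum _ fun i _ => (hv i).1
  have hbd : |∫ x, dirKb d b s x * R x| ≤ M * (b ^ (β/2) + b ^ (β/2 - 1) * (d * ∑ i : Fin d, ((d + 1) ^ 2 + (d + 1) + 3) * b)) := by
    rw [← Real.norm_eq_abs]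
    refine (norm_integral_le_of_norm_le hdom ?_).trans ?_
    · filter_upwards [ae_So_or_zero b s] with x hx
      rcases hx with hx | hx
      · rw [norm_mul, Real.norm_of_nonneg (hKn x), Real.norm_eq_abs]
        have h1 := hT s hs x hx
        have h2 := rpow_split (l1_nonneg s x) hb hβ1 hβ2
        have h3 : (∑ i, |x i - s i|) ^ 2 ≤ d * ∑ i, (x i - s i) ^ 2 := by
          have := sq_sum_le_card_mul_sum_sq (s := Finset.univ) (f := fun i => |x i - s i|)
          simpa using this
        have hbp : 0 ≤ b ^ (β/2 - 1) := by positivity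
        calc dirKb d b s x * |R x| ≤ dirKb d b s x * (M * (b ^ (β/2) + b ^ (β/2 - 1) * (d * ∑ i, (x i - s i) ^ 2))) := by
              apply mul_le_mul_of_nonneg_left _ (hKn x)
              refine h1.trans ?_
              apply mul_le_mul_of_nonneg_left _ hM
              refine h2.trans ?_
              gcongr
          _ = _ := by rw [← Finset.mul_sum]; ring
      · rw [hx.2]; simp
    · rw [integral_const_mul, integral_add (hK.const_mul _)]
      · rw [integral_const_mul, integral_const_mul, integral_const_mul, integral_finsetSum _ fun i _ => (hv i).1,
          integral_dirKb hb hsS, mul_one]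
        gcongr with i _
        exact (hv i).2
      · apply Integrable.const_mul
        apply Integrable.const_mul
        exact integrable_finsetSum _ fun i _ => (hv i).1
  have hlinb : |∑ i, G s i * ∫ x, dirKb d b s x * (x i - s i)| ≤ ∑ i : Fin d, M * ((d + 2) * b) := by
    refine (Finset.abs_sum_le_sum_abs _ _).trans (Finset.sum_le_sum fun i _ => ?_)
    rw [abs_mul]
    exact mul_le_mul (hG s hs i) (hm i).2 (abs_nonneg _) hM
  have hbb : b ≤ b ^ (β/2) := by
    calc b = b ^ (1:ℝ) := by simp
      _ ≤ b ^ (β/2) := Real.rpow_le_rpow_of_exponent_ge hb hb1 (by linarith)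
  have hb2 : b ^ (β/2 - 1) * b = b ^ (β/2) := by
    rw [← Real.rpow_add_one hb.ne']; congr 1; ring
  have : (∫ x, dirKb d b s x * f x) - f s = (∫ x, dirKb d b s x * R x) + ∑ i, G s i * ∫ x, dirKb d b s x * (x i - s i) := by
    rw [hKR]; ring
  rw [this]
  refine (abs_add_le _ _).trans ((add_le_add hbd hlinb).trans ?_)
  simp only [Finset.sum_const, Finset.card_univ, Fintype.card_fin, nsmul_eq_mul]
  rw [Cbias, add_mul (M * _)]
  apply add_le_add
  · apply le_of_eq
    linear_combination (M * (d * (d * (((d:ℝ) + 1) ^ 2 + (d + 1) + 3)))) * hb2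
  · calc (d:ℝ) * (M * ((d + 2) * b)) = d * (M * (d + 2)) * b := by ring
      _ ≤ _ := by gcongr

lemma iadd {Ω : Type*} [MeasurableSpace Ω] {P : Measure Ω} {f g : Ω → ℝ} (hf : Integrable f P)
    (hg : Integrable g P) : Integrable (fun x => f x + g x) P := hf.add hg

lemma int_pow_of_bdd {Ω : Type*} [MeasurableSpace Ω] {P : Measure Ω} [IsProbabilityMeasure P]
    {S : Ω → ℝ} {C : ℝ} (hm : Measurable S) (hC : ∀ ω, |S ω| ≤ C) (k : ℕ) :
    Integrable (fun ω => S ω ^ k) P := by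
  refine Integrable.of_bound (hm.pow_const k).aestronglyMeasurable (C ^ k) ?_
  refine Filter.Eventually.of_forall fun ω => ?_
  rw [norm_pow, Real.norm_eq_abs]
  exact pow_le_pow_left₀ (abs_nonneg _) (hC ω) k

lemma moments {Ω ι : Type*} [MeasurableSpace Ω] {P : Measure Ω} [IsProbabilityMeasure P]
    {Y : ι → Ω → ℝ} (hm : ∀ i, Measurable (Y i)) (hind : ProbabilityTheory.iIndepFun Y P)
    {B v : ℝ} (hB : ∀ i ω, |Y i ω| ≤ B) (h0 : ∀ i, ∫ ω, Y i ω ∂P = 0)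
    (hv : ∀ i, ∫ ω, (Y i ω) ^ 2 ∂P ≤ v) (hB0 : 0 ≤ B) (hv0 : 0 ≤ v) (t : Finset ι) :
    ∫ ω, (∑ i ∈ t, Y i ω) ^ 2 ∂P ≤ t.card * v ∧
    ∫ ω, (∑ i ∈ t, Y i ω) ^ 4 ∂P ≤ t.card * (B ^ 2 * v) + 3 * (t.card : ℝ) ^ 2 * v ^ 2 := by
  classical
  induction t using Finset.induction_on with
  | empty => simp
  | insert a t ha ih =>
    obtain ⟨ih2, ih4⟩ := ih
    set S : Ω → ℝ := fun ω => ∑ i ∈ t, Y i ω with hS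
    have hSm : Measurable S := Finset.measurable_sum _ fun i _ => hm i
    have hSB : ∀ ω, |S ω| ≤ t.card * B := fun ω => by
      refine (Finset.abs_sum_le_sum_abs _ _).trans ?_
      refine (Finset.sum_le_sum fun i _ => hB i ω).trans ?_
      simp
    have hSY : ProbabilityTheory.IndepFun S (Y a) P := by
      have := hind.indepFun_finsetSum_of_notMem hm ha
      convert this using 1
      ext ω; simp [hS]
    have hS0 : ∫ ω, S ω ∂P = 0 := by
      rw [hS, integral_finsetSum]
      · simp [h0]
      · intro i _
        simpa using int_pow_of_bdd (P := P) (hm i) (hB i) 1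
    have hprod : ∀ j k : ℕ, Integrable (fun ω => S ω ^ j * Y a ω ^ k) P ∧
        ∫ ω, S ω ^ j * Y a ω ^ k ∂P = (∫ ω, S ω ^ j ∂P) * ∫ ω, Y a ω ^ k ∂P := by
      intro j k
      have hi : ProbabilityTheory.IndepFun (fun ω => S ω ^ j) (fun ω => Y a ω ^ k) P :=
        hSY.comp (φ := fun x : ℝ => x ^ j) (ψ := fun x : ℝ => x ^ k) (by fun_prop) (by fun_prop)
      refine ⟨?_, ?_⟩
      · exact hi.integrable_mul (int_pow_of_bdd hSm hSB j) (int_pow_of_bdd (hm a) (hB a) k)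
      · exact hi.integral_fun_mul_eq_mul_integral (hSm.pow_const j).aestronglyMeasurable
          ((hm a).pow_const k).aestronglyMeasurable
    have hY0 : ∫ ω, Y a ω ^ 1 ∂P = 0 := by simpa using h0 a
    have hS1 : ∫ ω, S ω ^ 1 ∂P = 0 := by simpa using hS0
    have hSi := fun k => int_pow_of_bdd (P := P) hSm hSB k
    have hYi := fun k => int_pow_of_bdd (P := P) (hm a) (hB a) k
    have e2 : ∫ ω, (∑ i ∈ insert a t, Y i ω) ^ 2 ∂P = ∫ ω, S ω ^ 2 ∂P + ∫ ω, Y a ω ^ 2 ∂P := by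
      have : ∀ ω, (∑ i ∈ insert a t, Y i ω) ^ 2 = S ω ^ 2 + 2 * (S ω ^ 1 * Y a ω ^ 1) + Y a ω ^ 2 := by
        intro ω; rw [Finset.sum_insert ha]; ring
      simp_rw [this]
      rw [integral_add (iadd (hSi 2) ((hprod 1 1).1.const_mul 2)) (hYi 2),
        integral_add (hSi 2) ((hprod 1 1).1.const_mul 2), integral_const_mul, (hprod 1 1).2, hY0]
      ring
    have e4 : ∫ ω, (∑ i ∈ insert a t, Y i ω) ^ 4 ∂P = ∫ ω, S ω ^ 4 ∂P +
        6 * ((∫ ω, S ω ^ 2 ∂P) * ∫ ω, Y a ω ^ 2 ∂P) + ∫ ω, Y a ω ^ 4 ∂P := by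
      have : ∀ ω, (∑ i ∈ insert a t, Y i ω) ^ 4 = S ω ^ 4 + 4 * (S ω ^ 3 * Y a ω ^ 1) +
          6 * (S ω ^ 2 * Y a ω ^ 2) + 4 * (S ω ^ 1 * Y a ω ^ 3) + Y a ω ^ 4 := by
        intro ω; rw [Finset.sum_insert ha]; ring
      simp_rw [this]
      have i1 := iadd (hSi 4) ((hprod 3 1).1.const_mul 4)
      have i2 := iadd i1 ((hprod 2 2).1.const_mul 6)
      have i3 := iadd i2 ((hprod 1 3).1.const_mul 4)
      rw [integral_add i3 (hYi 4), integral_add i2 ((hprod 1 3).1.const_mul 4),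
        integral_add i1 ((hprod 2 2).1.const_mul 6), integral_add (hSi 4) ((hprod 3 1).1.const_mul 4),
        integral_const_mul, integral_const_mul, integral_const_mul,
        (hprod 3 1).2, (hprod 2 2).2, (hprod 1 3).2, hY0, hS1]
      ring
    have hY4 : ∫ ω, Y a ω ^ 4 ∂P ≤ B ^ 2 * v := by
      calc ∫ ω, Y a ω ^ 4 ∂P ≤ ∫ ω, B ^ 2 * Y a ω ^ 2 ∂P := by
            refine integral_mono (hYi 4) ((hYi 2).const_mul _) fun ω => ?_
            have : Y a ω ^ 2 ≤ B ^ 2 := sq_le_sq' (abs_le.1 (hB a ω)).1 (abs_le.1 (hB a ω)).2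
            calc Y a ω ^ 4 = Y a ω ^ 2 * Y a ω ^ 2 := by ring
              _ ≤ B ^ 2 * Y a ω ^ 2 := mul_le_mul_of_nonneg_right this (sq_nonneg _)
        _ = B ^ 2 * ∫ ω, Y a ω ^ 2 ∂P := integral_const_mul _ _
        _ ≤ _ := mul_le_mul_of_nonneg_left (hv a) (sq_nonneg _)
    have hS2n : 0 ≤ ∫ ω, S ω ^ 2 ∂P := integral_nonneg fun ω => sq_nonneg _
    have hY2n : 0 ≤ ∫ ω, Y a ω ^ 2 ∂P := integral_nonneg fun ω => sq_nonneg _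
    have hcross : (∫ ω, S ω ^ 2 ∂P) * ∫ ω, Y a ω ^ 2 ∂P ≤ (t.card * v) * v :=
      mul_le_mul ih2 (hv a) hY2n (by positivity)
    rw [e2, e4, Finset.card_insert_of_notMem ha]
    push_cast
    refine ⟨by linarith [hv a], ?_⟩
    have := sq_nonneg v
    nlinarith [ih4, hcross, hY4]

/-- interpolation, small p -/
lemma interp_small {p a x : ℝ} (hp1 : 1 ≤ p) (hp : p ≤ 2) (ha : 0 < a) :
    |x| ^ p ≤ a ^ p + a ^ (p - 2) * x ^ 2 := by
  rcases le_total |x| a with h | h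
  · have h1 := Real.rpow_le_rpow (abs_nonneg x) h (by linarith : 0 ≤ p)
    have : 0 ≤ a ^ (p - 2) * x ^ 2 := by positivity
    linarith
  · have hx : 0 < |x| := ha.trans_le h
    have : |x| ^ p = |x| ^ (p - 2) * x ^ 2 := by
      rw [← sq_abs, ← Real.rpow_natCast, ← Real.rpow_add hx]; congr 1; push_cast; ring
    rw [this]
    have h1 : |x| ^ (p - 2) ≤ a ^ (p - 2) := Real.rpow_le_rpow_of_nonpos ha h (by linarith)
    have := mul_le_mul_of_nonneg_right h1 (sq_nonneg x)
    have : 0 ≤ a ^ p := by positivity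
    linarith

lemma interp_large {p a x : ℝ} (hp1 : 2 ≤ p) (hp : p ≤ 4) (ha : 0 < a) :
    |x| ^ p ≤ a ^ (p - 2) * x ^ 2 + a ^ (p - 4) * x ^ 4 := by
  rcases (abs_nonneg x).eq_or_lt with hx | hx
  · rw [← hx, Real.zero_rpow (by linarith)]; positivity
  rcases le_total |x| a with h | h
  · have : |x| ^ p = |x| ^ (p - 2) * x ^ 2 := by
      rw [← sq_abs, ← Real.rpow_natCast, ← Real.rpow_add hx]; congr 1; push_cast; ring
    rw [this]
    have h1 : |x| ^ (p - 2) ≤ a ^ (p - 2) := Real.rpow_le_rpow hx.le h (by linarith)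
    have := mul_le_mul_of_nonneg_right h1 (sq_nonneg x)
    have : 0 ≤ a ^ (p - 4) * x ^ 4 := by positivity
    linarith
  · have e4 : x ^ 4 = |x| ^ (4:ℕ) := by rw [← abs_pow]; exact (abs_of_nonneg (by positivity)).symm
    have : |x| ^ p = |x| ^ (p - 4) * x ^ 4 := by
      rw [e4, ← Real.rpow_natCast, ← Real.rpow_add hx]; congr 1; push_cast; ring
    rw [this]
    have h1 : |x| ^ (p - 4) ≤ a ^ (p - 4) := Real.rpow_le_rpow_of_nonpos ha h (by linarith)
    have := mul_le_mul_of_nonneg_right h1 (by positivity : 0 ≤ x ^ 4)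
    have : 0 ≤ a ^ (p - 2) * x ^ 2 := by positivity
    linarith

/-- p-th absolute moment from second and fourth. -/
lemma p_moment {Ω : Type*} [MeasurableSpace Ω] {P : Measure Ω} [IsProbabilityMeasure P]
    {T : Ω → ℝ} {C M w p : ℝ} (hm : Measurable T) (hC : ∀ ω, |T ω| ≤ C) (hw : 0 < w) (hM : 1 ≤ M)
    (hp1 : 1 ≤ p) (hp3 : p < 3)
    (h2 : ∫ ω, T ω ^ 2 ∂P ≤ M * w) (h4 : ∫ ω, T ω ^ 4 ∂P ≤ M * w ^ 3 + 3 * M ^ 2 * w ^ 2) :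
    ∫⁻ ω, ENNReal.ofReal (|T ω| ^ p) ∂P ≤
      ENNReal.ofReal (5 * M ^ 2 * (w ^ (p / 2) + if p ≤ 2 then 0 else w ^ (p - 1))) := by
  have i2 := int_pow_of_bdd (P := P) hm hC 2
  have i4 := int_pow_of_bdd (P := P) hm hC 4
  have hMM : M ≤ M ^ 2 := by nlinarith
  split_ifs with hp
  · set a := w ^ (1/2 : ℝ) with ha
    have ha0 : 0 < a := by positivity
    have hle : ∫⁻ ω, ENNReal.ofReal (|T ω| ^ p) ∂P ≤ ∫⁻ ω, ENNReal.ofReal (a ^ p + a ^ (p - 2) * T ω ^ 2) ∂P :=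
      lintegral_mono fun ω => ENNReal.ofReal_le_ofReal (interp_small hp1 hp ha0)
    refine hle.trans ?_
    rw [← ofReal_integral_eq_lintegral_ofReal (iadd (integrable_const (a ^ p)) (i2.const_mul (a ^ (p - 2))))
      (Filter.Eventually.of_forall fun ω => by positivity)]
    refine ENNReal.ofReal_le_ofReal ?_
    rw [integral_add (integrable_const _) (i2.const_mul _), integral_const_mul]
    simp only [integral_const, probReal_univ, smul_eq_mul, one_mul, add_zero]
    have e1 : a ^ p = w ^ (p / 2) := by rw [ha, ← Real.rpow_mul hw.le]; congr 1; ring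
    have e2 : a ^ (p - 2) * w = w ^ (p / 2) := by
      rw [ha, ← Real.rpow_mul hw.le, ← Real.rpow_add_one hw.ne']; congr 1; ring
    have hh := mul_le_mul_of_nonneg_left h2 (by positivity : 0 ≤ a ^ (p - 2))
    have : a ^ (p - 2) * (M * w) = M * w ^ (p / 2) := by rw [← e2]; ring
    rw [this] at hh
    rw [e1]
    have : 0 < w ^ (p/2) := by positivity
    nlinarith
  · push Not at hp
    set a := max (w ^ (1/2 : ℝ)) w with ha
    have ha0 : 0 < a := lt_max_of_lt_right hw
    have hle : ∫⁻ ω, ENNReal.ofReal (|T ω| ^ p) ∂P ≤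
        ∫⁻ ω, ENNReal.ofReal (a ^ (p - 2) * T ω ^ 2 + a ^ (p - 4) * T ω ^ 4) ∂P :=
      lintegral_mono fun ω => ENNReal.ofReal_le_ofReal (interp_large hp.le (by linarith) ha0)
    refine hle.trans ?_
    rw [← ofReal_integral_eq_lintegral_ofReal (iadd (i2.const_mul (a ^ (p - 2))) (i4.const_mul (a ^ (p - 4))))
      (Filter.Eventually.of_forall fun ω => by positivity)]
    refine ENNReal.ofReal_le_ofReal ?_
    rw [integral_add (i2.const_mul _) (i4.const_mul _), integral_const_mul, integral_const_mul]
    have hwa : w ≤ a := le_max_right _ _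
    have hwa2 : w ≤ a ^ 2 := by
      have h1 : w ^ (1/2:ℝ) ≤ a := le_max_left _ _
      have h2 : (w ^ (1/2:ℝ)) ^ 2 = w := by
        rw [← Real.rpow_natCast, ← Real.rpow_mul hw.le]; norm_num
      rw [← h2]; gcongr
    have e4 : a ^ (p - 2) = a ^ (p - 4) * a ^ 2 := by
      rw [← Real.rpow_natCast, ← Real.rpow_add ha0]; congr 1; push_cast; ring
    have hq : 0 ≤ a ^ (p - 4) := by positivity
    have hq2 : 0 ≤ a ^ (p - 2) := by positivity
    have k2 : a ^ (p - 2) * ∫ ω, T ω ^ 2 ∂P ≤ M * (a ^ (p - 2) * w) := by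
      have := mul_le_mul_of_nonneg_left h2 hq2; linarith
    have k3 : a ^ (p - 4) * w ^ 3 ≤ a ^ (p - 2) * w := by
      rw [e4, mul_assoc]; refine mul_le_mul_of_nonneg_left ?_ hq
      have : w ^ 2 ≤ a ^ 2 := by gcongr
      nlinarith
    have k4 : a ^ (p - 4) * w ^ 2 ≤ a ^ (p - 2) * w := by
      rw [e4, mul_assoc]; refine mul_le_mul_of_nonneg_left ?_ hq
      nlinarith
    have k5 : a ^ (p - 4) * ∫ ω, T ω ^ 4 ∂P ≤ (M + 3 * M ^ 2) * (a ^ (p - 2) * w) := by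
      have := mul_le_mul_of_nonneg_left h4 hq
      have r1 := mul_le_mul_of_nonneg_left k3 (by linarith : 0 ≤ M)
      have r2 := mul_le_mul_of_nonneg_left k4 (by positivity : 0 ≤ 3 * M ^ 2)
      nlinarith
    have k6 : a ^ (p - 2) * w ≤ w ^ (p / 2) + w ^ (p - 1) := by
      have u1 : (w ^ (1/2 : ℝ)) ^ (p - 2) * w = w ^ (p / 2) := by
        rw [← Real.rpow_mul hw.le, ← Real.rpow_add_one hw.ne']; congr 1; ring
      have u2 : w ^ (p - 2) * w = w ^ (p - 1) := by
        rw [← Real.rpow_add_one hw.ne']; congr 1; ring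
      have v1 : 0 < w ^ (p / 2) := by positivity
      have v2 : 0 < w ^ (p - 1) := by positivity
      rcases max_choice (w ^ (1/2 : ℝ)) w with h | h
      · rw [ha, h, u1]; linarith
      · rw [ha, h, u2]; linarith
    have k7 : 0 ≤ a ^ (p - 2) * w := by positivity
    nlinarith

lemma mean_moment {α : Type*} [MeasurableSpace α] {μ : Measure α} [IsProbabilityMeasure μ]
    {k : α → ℝ} (hk : Measurable k) {A M p : ℝ} (hA : 0 < A) (hk0 : ∀ x, 0 ≤ k x) (hkA : ∀ x, k x ≤ A)
    (hM : 1 ≤ M) (hkM : ∫ x, k x ∂μ ≤ M) (hp1 : 1 ≤ p) (hp3 : p < 3) {n : ℕ} (hn : 0 < n) :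
    ∫⁻ ω, ENNReal.ofReal (|(n : ℝ)⁻¹ * ∑ i, k (ω i) - ∫ x, k x ∂μ| ^ p)
        ∂(Measure.pi (fun _ : Fin n => μ)) ≤
      ENNReal.ofReal (5 * M ^ 2 * ((A / n) ^ (p / 2) + if p ≤ 2 then 0 else (A / n) ^ (p - 1))) := by
  set e := ∫ x, k x ∂μ with he
  have hki : Integrable k μ := by
    simpa using int_pow_of_bdd (P := μ) hk (C := A) (fun x => by rw [abs_of_nonneg (hk0 x)]; exact hkA x) 1
  have hk2i : Integrable (fun x => k x ^ 2) μ :=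
    int_pow_of_bdd (P := μ) hk (C := A) (fun x => by rw [abs_of_nonneg (hk0 x)]; exact hkA x) 2
  have he0 : 0 ≤ e := integral_nonneg hk0
  have heA : e ≤ A := by
    have : e ≤ ∫ _x, A ∂μ := integral_mono hki (integrable_const A) hkA
    simpa using this
  have hn' : (0:ℝ) < n := by exact_mod_cast hn
  set P := Measure.pi (fun _ : Fin n => μ) with hP
  set Z : α → ℝ := fun x => k x - e with hZ
  have hZm : Measurable Z := hk.sub_const e
  set Y : Fin n → (Fin n → α) → ℝ := fun i ω => Z (ω i) with hY
  have hYm : ∀ i, Measurable (Y i) := fun i => hZm.comp (measurable_pi_apply i)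
  have hind : ProbabilityTheory.iIndepFun Y P :=
    ProbabilityTheory.iIndepFun_pi (X := fun _ => Z) (μ := fun _ : Fin n => μ) (fun _ => hZm.aemeasurable)
  have hZA : ∀ x, |Z x| ≤ A := fun x => by
    rw [abs_le]; constructor <;> simp only [hZ] <;> linarith [hk0 x, hkA x]
  have hev : ∀ (i : Fin n) (g : α → ℝ), Measurable g → ∫ ω, g (ω i) ∂P = ∫ x, g x ∂μ := by
    intro i g hg
    have := measurePreserving_eval (fun _ : Fin n => μ) i
    rw [← this.map_eq, integral_map (measurable_pi_apply i).aemeasurable hg.aestronglyMeasurable]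
  have h0 : ∀ i, ∫ ω, Y i ω ∂P = 0 := fun i => by
    rw [hev i Z hZm, hZ, integral_sub hki (integrable_const e)]; simp [he]
  have hv : ∀ i, ∫ ω, (Y i ω) ^ 2 ∂P ≤ A * M := fun i => by
    rw [hev i (fun x => Z x ^ 2) (hZm.pow_const 2)]
    have : ∀ x, Z x ^ 2 = (k x ^ 2 - 2 * e * k x) + e ^ 2 := fun x => by simp only [hZ]; ring
    simp_rw [this]
    have j1 : Integrable (fun x => k x ^ 2 - 2 * e * k x) μ := hk2i.sub (hki.const_mul _)
    rw [integral_add j1 (integrable_const _), integral_sub hk2i (hki.const_mul _),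
      integral_const_mul, ← he]
    have : ∫ x, k x ^ 2 ∂μ ≤ ∫ x, A * k x ∂μ := by
      refine integral_mono hk2i (hki.const_mul _) fun x => ?_
      simp only
      nlinarith [hk0 x, hkA x]
    rw [integral_const_mul, ← he] at this
    simp only [integral_const, probReal_univ, smul_eq_mul, one_mul]
    nlinarith
  have hmom := moments hYm hind (fun i ω => hZA (ω i)) h0 hv hA.le (by positivity) Finset.univ
  simp only [Finset.card_univ, Fintype.card_fin] at hmom
  set T : (Fin n → α) → ℝ := fun ω => (n : ℝ)⁻¹ * ∑ i, k (ω i) - e with hT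
  have hTe : ∀ ω, T ω = (n : ℝ)⁻¹ * ∑ i, Y i ω := fun ω => by
    simp only [hT, hY, hZ, Finset.sum_sub_distrib]
    simp only [Finset.sum_const, Finset.card_univ, Fintype.card_fin, nsmul_eq_mul]
    field_simp
  have hTm : Measurable T := by
    have : T = fun ω => (n : ℝ)⁻¹ * ∑ i, Y i ω := funext hTe
    rw [this]; exact (Finset.measurable_sum _ fun i _ => hYm i).const_mul _
  have hTA : ∀ ω, |T ω| ≤ A := fun ω => by
    rw [hTe, abs_mul, abs_of_pos (inv_pos.2 hn')]
    have : |∑ i, Y i ω| ≤ n * A := by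
      refine (Finset.abs_sum_le_sum_abs _ _).trans ?_
      refine (Finset.sum_le_sum fun i _ => hZA (ω i)).trans ?_
      simp
    rw [inv_mul_le_iff₀ hn']; exact this
  refine p_moment hTm hTA (by positivity) hM hp1 hp3 ?_ ?_
  · have hq : ∀ ω, T ω ^ 2 = ((n:ℝ)⁻¹) ^ 2 * (∑ i, Y i ω) ^ 2 := fun ω => by rw [hTe, mul_pow]
    rw [integral_congr_ae (Filter.Eventually.of_forall hq), integral_const_mul]
    calc _ ≤ ((n:ℝ)⁻¹) ^ 2 * (n * (A * M)) := by
          refine mul_le_mul_of_nonneg_left hmom.1 (by positivity)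
      _ = _ := by field_simp
  · have hq : ∀ ω, T ω ^ 4 = ((n:ℝ)⁻¹) ^ 4 * (∑ i, Y i ω) ^ 4 := fun ω => by rw [hTe, mul_pow]
    rw [integral_congr_ae (Filter.Eventually.of_forall hq), integral_const_mul]
    calc _ ≤ ((n:ℝ)⁻¹) ^ 4 * (n * (A ^ 2 * (A * M)) + 3 * (n:ℝ) ^ 2 * (A * M) ^ 2) := by
          refine mul_le_mul_of_nonneg_left hmom.2 (by positivity)
      _ = _ := by field_simp

lemma pi_withDensity {α : Type*} [MeasureSpace α] [SigmaFinite (volume : Measure α)] {F : α → ℝ}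
    (hFm : Measurable F) (hF0 : ∀ x, 0 ≤ F x) (hFi : Integrable F) (n : ℕ) :
    Measure.pi (fun _ : Fin n => (volume : Measure α).withDensity (fun x => ENNReal.ofReal (F x))) =
      (volume : Measure (Fin n → α)).withDensity (fun ω => ENNReal.ofReal (∏ i, F (ω i))) := by
  have : IsFiniteMeasure ((volume : Measure α).withDensity (fun x => ENNReal.ofReal (F x))) :=
    isFiniteMeasure_withDensity_ofReal hFi.2
  refine Measure.pi_eq fun s hs => ?_
  rw [withDensity_apply _ (MeasurableSet.univ_pi hs), ← lintegral_indicator (MeasurableSet.univ_pi hs)]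
  have e1 : ∀ ω : Fin n → α, (Set.univ.pi s).indicator (fun ω => ENNReal.ofReal (∏ i, F (ω i))) ω =
      ENNReal.ofReal (∏ i, (s i).indicator F (ω i)) := by
    intro ω
    by_cases h : ω ∈ Set.univ.pi s
    · rw [Set.indicator_of_mem h]
      congr 1
      refine Finset.prod_congr rfl fun i _ => ?_
      rw [Set.indicator_of_mem (h i (Set.mem_univ i))]
    · rw [Set.indicator_of_notMem h]
      simp only [Set.mem_univ_pi, not_forall] at h
      obtain ⟨i, hi⟩ := h
      rw [Finset.prod_eq_zero (Finset.mem_univ i) (Set.indicator_of_notMem hi F), ENNReal.ofReal_zero]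
  simp_rw [e1]
  have hii : ∀ i, Integrable ((s i).indicator F) := fun i => hFi.indicator (hs i)
  have h0 : ∀ i x, 0 ≤ (s i).indicator F x := fun i x => Set.indicator_nonneg (fun x _ => hF0 x) x
  have hip : Integrable (fun ω : Fin n → α => ∏ i, (s i).indicator F (ω i)) := Integrable.fintype_prod hii
  rw [← ofReal_integral_eq_lintegral_ofReal hip
    (Filter.Eventually.of_forall fun ω => Finset.prod_nonneg fun i _ => h0 i _),
    integral_fintype_prod_volume_eq_prod, ENNReal.ofReal_prod_of_nonneg (fun i _ => integral_nonneg (h0 i))]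
  refine Finset.prod_congr rfl fun i _ => ?_
  rw [withDensity_apply _ (hs i), ofReal_integral_eq_lintegral_ofReal (hii i) (Filter.Eventually.of_forall (h0 i)),
    ← lintegral_indicator (hs i)]
  refine lintegral_congr fun x => ?_
  by_cases h : x ∈ s i <;> simp [h]

def gam1 (x : ℝ) : ℝ := Real.Gamma (max x 1)

lemma measurable_gam1 : Measurable gam1 := by
  have : Continuous gam1 := by
    rw [continuous_iff_continuousAt]
    intro x
    have h1 : ContinuousAt Real.Gamma (max x 1) := by
      refine (Real.differentiableAt_Gamma fun m h => ?_).continuousAt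
      have : (1:ℝ) ≤ max x 1 := le_max_right _ _
      have : (0:ℝ) ≤ m := Nat.cast_nonneg m
      linarith
    exact ContinuousAt.comp (g := Real.Gamma) (f := fun x => max x 1) h1 (by fun_prop)
  exact this.measurable

lemma gam1_eq {x : ℝ} (h : 1 ≤ x) : gam1 x = Real.Gamma x := by rw [gam1, max_eq_left h]

/-- jointly measurable version of the kernel -/
def kj (d : ℕ) (b : ℝ) (s x : Fin d → ℝ) : ℝ :=
  Set.indicator (Sd d) (fun _ => (1:ℝ)) x *
    (gam1 (((1 - ∑ i, s i) / b + 1) + ∑ i, (s i / b + 1)) /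
      (gam1 ((1 - ∑ i, s i) / b + 1) * ∏ i, gam1 (s i / b + 1)) *
      (1 - ∑ i, x i) ^ (((1 - ∑ i, s i) / b + 1) - 1) * ∏ i, (x i) ^ ((s i / b + 1) - 1))

lemma measurable_kj (d : ℕ) (b : ℝ) :
    Measurable (fun q : (Fin d → ℝ) × (Fin d → ℝ) => kj d b q.1 q.2) := by
  unfold kj
  have h1 : Measurable (fun q : (Fin d → ℝ) × (Fin d → ℝ) => Set.indicator (Sd d) (fun _ => (1:ℝ)) q.2) :=
    (measurable_const.indicator (measurableSet_Sd d)).comp measurable_snd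
  have hs : ∀ i, Measurable (fun q : (Fin d → ℝ) × (Fin d → ℝ) => q.1 i) := fun i => by fun_prop
  have hx : ∀ i, Measurable (fun q : (Fin d → ℝ) × (Fin d → ℝ) => q.2 i) := fun i => by fun_prop
  have hss : Measurable (fun q : (Fin d → ℝ) × (Fin d → ℝ) => ∑ i, q.1 i) := Finset.measurable_sum _ fun i _ => hs i
  have hxs : Measurable (fun q : (Fin d → ℝ) × (Fin d → ℝ) => ∑ i, q.2 i) := Finset.measurable_sum _ fun i _ => hx i
  have hv : Measurable (fun q : (Fin d → ℝ) × (Fin d → ℝ) => (1 - ∑ i, q.1 i) / b + 1) := by fun_prop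
  have hu : ∀ i, Measurable (fun q : (Fin d → ℝ) × (Fin d → ℝ) => q.1 i / b + 1) := fun i => by fun_prop
  have hus : Measurable (fun q : (Fin d → ℝ) × (Fin d → ℝ) => ∑ i, (q.1 i / b + 1)) := Finset.measurable_sum _ fun i _ => hu i
  refine h1.mul ((Measurable.mul ?_ ?_).mul ?_)
  · refine (measurable_gam1.comp (hv.add hus)).div ((measurable_gam1.comp hv).mul ?_)
    exact Finset.measurable_prod _ fun i _ => measurable_gam1.comp (hu i)
  · exact (measurable_const.sub hxs).pow (hv.sub_const 1)
  · exact Finset.measurable_prod _ fun i _ => (hx i).pow ((hu i).sub_const 1)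

lemma kj_eq {d : ℕ} {b : ℝ} {s : Fin d → ℝ} (hb : 0 < b) (hs : s ∈ Sd d) (x : Fin d → ℝ) :
    kj d b s x = dirKb d b s x := by
  have h1 : ∀ i, 1 ≤ s i / b + 1 := fun i => by
    have : 0 ≤ s i / b := div_nonneg (hs.1 i).1 hb.le
    linarith
  have h2 : 1 ≤ (1 - ∑ i, s i) / b + 1 := by
    have : 0 ≤ (1 - ∑ i, s i) / b := div_nonneg (by linarith [hs.2]) hb.le
    linarith
  have h3 : 1 ≤ ((1 - ∑ i, s i) / b + 1) + ∑ i, (s i / b + 1) := by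
    have : 0 ≤ ∑ i, (s i / b + 1) := Finset.sum_nonneg fun i _ => by linarith [h1 i]
    linarith
  unfold kj dirKb dirK
  rw [gam1_eq h3, gam1_eq h2, Finset.prod_congr rfl fun i _ => gam1_eq (h1 i)]
  by_cases h : x ∈ Sd d
  · rw [Set.indicator_of_mem h, Set.indicator_of_mem h, one_mul]
  · rw [Set.indicator_of_notMem h, Set.indicator_of_notMem h, zero_mul]

lemma ofReal_integral_le {α : Type*} [MeasurableSpace α] {μ : Measure α} {g : α → ℝ} (hg : ∀ x, 0 ≤ g x) :
    ENNReal.ofReal (∫ x, g x ∂μ) ≤ ∫⁻ x, ENNReal.ofReal (g x) ∂μ := by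
  by_cases h : Integrable g μ
  · rw [ofReal_integral_eq_lintegral_ofReal h (Filter.Eventually.of_forall hg)]
  · rw [integral_undef h]; simp

lemma psi_int (d : ℕ) {r : ℝ} (hr : r < 2) :
    ∃ C, 0 ≤ C ∧ ∫⁻ s in So d 1, ENNReal.ofReal (psi d s ^ r) ≤ ENNReal.ofReal C := by
  have h := dir_lint d 1 (fun _ => 1 - r/2) (1 - r/2) one_pos (fun _ => by linarith) (by linarith)
  generalize hR : (Real.Gamma (1 - r / 2) * ∏ _i : Fin d, Real.Gamma (1 - r / 2)) /
    Real.Gamma (1 - r / 2 + ∑ _i : Fin d, (1 - r / 2)) *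
        (1:ℝ) ^ (1 - r / 2 + ∑ _i : Fin d, (1 - r / 2) - 1) = R at h
  refine ⟨max R 0, le_max_right _ _, ?_⟩
  · refine le_trans (le_of_eq ?_) (ENNReal.ofReal_le_ofReal (le_max_left _ _))
    rw [← h]
    refine setLIntegral_congr_fun (measurableSet_So d 1) fun s hs => ?_
    congr 1
    have h1 : 0 < 1 - ∑ i, s i := by linarith [hs.2]
    unfold psi
    rw [Real.mul_rpow (by positivity) (Finset.prod_nonneg fun i _ => Real.rpow_nonneg (hs.1 i).le _),
      ← Real.finsetProd_rpow _ _ (fun i _ => Real.rpow_nonneg (hs.1 i).le _), ← Real.rpow_mul h1.le]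
    congr 1
    · congr 1; ring
    · refine Finset.prod_congr rfl fun i _ => ?_
      rw [← Real.rpow_mul (hs.1 i).le]; congr 1; ring

/-- Reduction of the risk to an iterated Lebesgue integral with measurable representatives. -/
lemma risk_reduction {d n : ℕ} {b p : ℝ} {f F : (Fin d → ℝ) → ℝ} (hb : 0 < b)
    (hf0 : ∀ x, 0 ≤ f x) (hFf : ∀ s ∈ So d 1, F s = f s) (hFae : F =ᵐ[volume] f)
    (hFm : Measurable F) (hF0 : ∀ x, 0 ≤ F x) (hFi : Integrable F) :
    ENNReal.ofReal (lpRiskPow d n b p f) ≤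
      ∫⁻ s in So d 1, ∫⁻ ω, ENNReal.ofReal (|(n:ℝ)⁻¹ * ∑ i, dirKb d b s (ω i) - f s| ^ p)
        ∂(Measure.pi (fun _ : Fin n => (volume : Measure (Fin d → ℝ)).withDensity (fun x => ENNReal.ofReal (F x)))) := by
  set H : (Fin n → Fin d → ℝ) → (Fin d → ℝ) → ℝ≥0∞ := fun ω s =>
    ENNReal.ofReal (|(n:ℝ)⁻¹ * ∑ i, kj d b s (ω i) - F s| ^ p) with hH
  have hHm : Measurable (Function.uncurry H) := by
    have hk : ∀ i, Measurable (fun q : (Fin n → Fin d → ℝ) × (Fin d → ℝ) => kj d b q.2 (q.1 i)) := fun i =>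
      (measurable_kj d b).comp (measurable_snd.prodMk ((measurable_pi_apply i).comp measurable_fst))
    have hsum : Measurable (fun q : (Fin n → Fin d → ℝ) × (Fin d → ℝ) => ∑ i, kj d b q.2 (q.1 i)) :=
      Finset.measurable_sum _ fun i _ => hk i
    have h2 : Measurable (fun q : (Fin n → Fin d → ℝ) × (Fin d → ℝ) =>
        (n:ℝ)⁻¹ * ∑ i, kj d b q.2 (q.1 i) - F q.2) := (hsum.const_mul _).sub (hFm.comp measurable_snd)
    exact ((continuous_abs.measurable.comp h2).pow_const p).ennreal_ofReal
  have hHe : ∀ ω, ∀ s ∈ So d 1, H ω s = ENNReal.ofReal (|(n:ℝ)⁻¹ * ∑ i, dirKb d b s (ω i) - f s| ^ p) := by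
    intro ω s hs
    simp only [hH]
    rw [hFf s hs, Finset.sum_congr rfl fun i _ => kj_eq hb (So_subset_Sd d hs) (ω i)]
  have hI : ∀ ω, ENNReal.ofReal (∫ s in Sd d, |fhat d n b ω s - f s| ^ p) ≤ ∫⁻ s in So d 1, H ω s := by
    intro ω
    rw [restrict_Sd]
    refine (ofReal_integral_le fun s => by positivity).trans (le_of_eq ?_)
    exact setLIntegral_congr_fun (measurableSet_So d 1) fun s hs => (hHe ω s hs).symm
  have hae : ∀ᵐ ω : Fin n → Fin d → ℝ, ∏ i, f (ω i) = ∏ i, F (ω i) := by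
    have : ∀ i : Fin n, ∀ᵐ ω : Fin n → Fin d → ℝ, F (ω i) = f (ω i) := fun i =>
      (Measure.tendsto_eval_ae_ae (μ := fun _ : Fin n => (volume : Measure (Fin d → ℝ))) (i := i)).eventually hFae
    filter_upwards [ae_all_iff.2 this] with ω hω
    exact Finset.prod_congr rfl fun i _ => (hω i).symm
  have hJm : Measurable (fun ω => ∫⁻ s in So d 1, H ω s) := hHm.lintegral_prod_right'
  have hPm : Measurable (fun ω : Fin n → Fin d → ℝ => ENNReal.ofReal (∏ i, F (ω i))) :=
    (Finset.measurable_prod _ fun i _ => hFm.comp (measurable_pi_apply i)).ennreal_ofReal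
  have : IsFiniteMeasure ((volume : Measure (Fin d → ℝ)).withDensity (fun x => ENNReal.ofReal (F x))) :=
    isFiniteMeasure_withDensity_ofReal hFi.2
  calc ENNReal.ofReal (lpRiskPow d n b p f)
      ≤ ∫⁻ ω : Fin n → Fin d → ℝ, ENNReal.ofReal ((∏ i, f (ω i)) * ∫ s in Sd d, |fhat d n b ω s - f s| ^ p) :=
        ofReal_integral_le fun ω => mul_nonneg (Finset.prod_nonneg fun i _ => hf0 _)
          (integral_nonneg fun s => by positivity)
    _ ≤ ∫⁻ ω : Fin n → Fin d → ℝ, ENNReal.ofReal (∏ i, F (ω i)) * ∫⁻ s in So d 1, H ω s := by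
        refine lintegral_mono_ae ?_
        filter_upwards [hae] with ω hω
        rw [ENNReal.ofReal_mul (Finset.prod_nonneg fun i _ => hf0 _), hω]
        gcongr
        exact hI ω
    _ = ∫⁻ ω, (∫⁻ s in So d 1, H ω s) ∂(Measure.pi (fun _ : Fin n => (volume : Measure (Fin d → ℝ)).withDensity (fun x => ENNReal.ofReal (F x)))) := by
        rw [pi_withDensity hFm hF0 hFi, lintegral_withDensity_eq_lintegral_mul _ hPm hJm]
        rfl
    _ = ∫⁻ s in So d 1, ∫⁻ ω, H ω s ∂(Measure.pi (fun _ : Fin n => (volume : Measure (Fin d → ℝ)).withDensity (fun x => ENNReal.ofReal (F x)))) :=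
        lintegral_lintegral_swap hHm.aemeasurable
    _ = _ := setLIntegral_congr_fun (measurableSet_So d 1) fun s hs =>
        lintegral_congr fun ω => hHe ω s hs

lemma pow_split {x y z p B : ℝ} (hp : 1 ≤ p) (hB : |y - z| ≤ B) :
    |x - z| ^ p ≤ 2 ^ p * |x - y| ^ p + 2 ^ p * B ^ p := by
  have hB0 : 0 ≤ B := (abs_nonneg _).trans hB
  have h1 : |x - z| ≤ 2 * max |x - y| B := by
    have := abs_sub_le x y z
    have := le_max_left |x - y| B
    have := le_max_right |x - y| B
    linarith
  have h2 := Real.rpow_le_rpow (abs_nonneg _) h1 (by linarith : 0 ≤ p)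
  rw [Real.mul_rpow (by norm_num) (by positivity)] at h2
  refine h2.trans ?_
  have : 0 ≤ 2 ^ p * |x - y| ^ p := by positivity
  have : 0 ≤ 2 ^ p * B ^ p := by positivity
  rcases max_choice |x - y| B with h | h <;> rw [h] <;> linarith

lemma risk_bound (d : ℕ) {β L p : ℝ} (hβ1 : 0 < β) (hβ2 : β ≤ 2) (hL : 0 < L) (hp1 : 1 ≤ p) (hp3 : p < 3) :
    ∃ C, 0 ≤ C ∧ ∀ f ∈ holderClass d β L, ∀ n : ℕ, 0 < n → ∀ b, 0 < b → b ≤ 1 →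
      lpRiskPow d n b p f ≤ C * ((b ^ (-(d:ℝ)/2) / n) ^ (p / 2) +
        (if p ≤ 2 then 0 else (b ^ (-(d:ℝ)/2) / n) ^ (p - 1)) + (b ^ (β / 2)) ^ p) := by
  obtain ⟨M, hM, hfacts⟩ := holder_facts d β L hβ1 hβ2 hL
  obtain ⟨C1, hC1, hI1⟩ := psi_int d (r := p / 2) (by linarith)
  obtain ⟨C2, hC2, hI2⟩ := psi_int d (r := p - 1) (by linarith)
  set V := (volume (So d 1)).toReal with hV
  have hVfin : volume (So d 1) ≠ ⊤ := by
    rw [measure_congr (So_ae_eq d)]; exact (volume_Sd_lt_top d).ne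
  have hV0 : 0 ≤ V := ENNReal.toReal_nonneg
  have hCs := Csup_pos d
  have hCb := Cbias_nonneg d (by linarith : 0 ≤ M)
  set D1 := 2 ^ p * (5 * M ^ 2 * Csup d ^ (p / 2)) * C1 with hD1
  set D2 := 2 ^ p * (5 * M ^ 2 * Csup d ^ (p - 1)) * C2 with hD2
  set D3 := 2 ^ p * Cbias d M ^ p * V with hD3
  have hD1' : 0 ≤ D1 := by positivity
  have hD2' : 0 ≤ D2 := by positivity
  have hD3' : 0 ≤ D3 := by positivity
  refine ⟨D1 + D2 + D3, by positivity, ?_⟩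
  intro f hf n hn b hb hb1
  obtain ⟨G, hfM, hG, hT⟩ := hfacts f hf
  obtain ⟨hfi, hf1⟩ := holder_integrable hf
  have hf0 := hf.1
  have hcont : ContinuousOn f (So d 1) := by
    have := hf.2.2.2.1.continuousOn
    rwa [interior_Sd] at this
  set F : (Fin d → ℝ) → ℝ := (So d 1).indicator f with hF
  have hFm : Measurable F := by
    have h1 : Measurable ((So d 1).indicator f) := by
      refine measurable_of_restrict_of_restrict_compl (measurableSet_So d 1) ?_ ?_
      · have : (So d 1).domRestrict ((So d 1).indicator f) = (So d 1).domRestrict f := by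
          ext x; exact Set.indicator_of_mem x.2 f
        rw [this]
        exact (continuousOn_iff_continuous_domRestrict.1 hcont).measurable
      · have : (So d 1)ᶜ.domRestrict ((So d 1).indicator f) = fun _ => 0 := by
          ext x; exact Set.indicator_of_notMem x.2 f
        rw [this]
        exact measurable_const
    exact h1
  have hFf : ∀ s ∈ So d 1, F s = f s := fun s hs => Set.indicator_of_mem hs f
  have hFae : F =ᵐ[volume] f := by
    filter_upwards [(So_ae_eq d).mem_iff] with x hx
    by_cases h : x ∈ So d 1
    · exact hFf x h
    · rw [hF, Set.indicator_of_notMem h, hf.2.1 x (fun h' => h (hx.2 h'))]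
  have hF0 : ∀ x, 0 ≤ F x := fun x => Set.indicator_nonneg (fun x _ => hf0 x) x
  have hFi : Integrable F := hfi.congr hFae.symm
  have hF1 : ∫ x, F x = 1 := by rw [integral_congr_ae hFae, hf1]
  set μ := (volume : Measure (Fin d → ℝ)).withDensity (fun x => ENNReal.ofReal (F x)) with hμ
  have : IsProbabilityMeasure μ := by
    refine ⟨?_⟩
    rw [hμ, withDensity_apply _ MeasurableSet.univ, Measure.restrict_univ,
      ← ofReal_integral_eq_lintegral_ofReal hFi (Filter.Eventually.of_forall hF0), hF1, ENNReal.ofReal_one]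
  have hn' : (0:ℝ) < n := by exact_mod_cast hn
  set W := b ^ (-(d:ℝ)/2) / n with hW
  have hW0 : 0 < W := by positivity
  set Q : ℝ := if p ≤ 2 then 0 else W ^ (p - 1) with hQ
  have hQ0 : 0 ≤ Q := by rw [hQ]; split_ifs <;> positivity
  have key : ∀ s ∈ So d 1, ∫⁻ ω, ENNReal.ofReal (|(n:ℝ)⁻¹ * ∑ i, dirKb d b s (ω i) - f s| ^ p)
      ∂(Measure.pi (fun _ : Fin n => μ)) ≤
      ENNReal.ofReal (2 ^ p * (5 * M ^ 2 * Csup d ^ (p / 2)) * W ^ (p / 2)) * ENNReal.ofReal (psi d s ^ (p / 2)) +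
      ENNReal.ofReal (2 ^ p * (5 * M ^ 2 * Csup d ^ (p - 1)) * Q) * ENNReal.ofReal (psi d s ^ (p - 1)) +
      ENNReal.ofReal (2 ^ p * Cbias d M ^ p * (b ^ (β / 2)) ^ p) := by
    intro s hs
    have hsS := So_subset_Sd d hs
    have hpsi := psi_pos hs
    have hmk : Measurable (dirKb d b s) := measurable_dirK d _ _
    have hintg : ∫ x, dirKb d b s x ∂μ = ∫ x, dirKb d b s x * f x := by
      rw [hμ, integral_withDensity_eq_integral_toReal_smul hFm.ennreal_ofReal
        (Filter.Eventually.of_forall fun x => ENNReal.ofReal_lt_top)]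
      refine integral_congr_ae ?_
      filter_upwards [hFae] with x hx
      rw [ENNReal.toReal_ofReal (hF0 x), hx, smul_eq_mul, mul_comm]
    have hkM : ∫ x, dirKb d b s x ∂μ ≤ M := by
      rw [hintg]; exact (kf_integrable hb hs (by linarith) hf0 hfi hfM).2
    have hbias := bias_bound hβ1 hβ2 hb hb1 hs (by linarith) hf0 hfi hfM hG hT
    rw [← hintg] at hbias
    have hA : 0 < Csup d * b ^ (-(d:ℝ)/2) * psi d s := by positivity
    have hmm := mean_moment (μ := μ) hmk hA (dirKb_nonneg hb hsS) (dirKb_sup hb hb1 hs) hM hkM hp1 hp3 hn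
    set e := ∫ x, dirKb d b s x ∂μ with he
    have hAn : Csup d * b ^ (-(d:ℝ)/2) * psi d s / n = Csup d * W * psi d s := by
      rw [hW]; ring
    rw [hAn] at hmm
    have hpw : ∀ r : ℝ, (Csup d * W * psi d s) ^ r = Csup d ^ r * W ^ r * psi d s ^ r := fun r => by
      rw [Real.mul_rpow (by positivity) hpsi.le, Real.mul_rpow hCs.le hW0.le]
    rw [hpw, hpw] at hmm
    have hmT : Measurable (fun ω : Fin n → Fin d → ℝ => ENNReal.ofReal (|(n:ℝ)⁻¹ * ∑ i, dirKb d b s (ω i) - e| ^ p)) := by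
      have : Measurable (fun ω : Fin n → Fin d → ℝ => ∑ i, dirKb d b s (ω i)) :=
        Finset.measurable_sum _ fun i _ => hmk.comp (measurable_pi_apply i)
      have h2 := (this.const_mul (n:ℝ)⁻¹).sub_const e
      exact ((continuous_abs.measurable.comp h2).pow_const p).ennreal_ofReal
    calc _ ≤ ∫⁻ ω, (ENNReal.ofReal (2 ^ p) * ENNReal.ofReal (|(n:ℝ)⁻¹ * ∑ i, dirKb d b s (ω i) - e| ^ p) +
            ENNReal.ofReal (2 ^ p * (Cbias d M * b ^ (β / 2)) ^ p)) ∂(Measure.pi (fun _ : Fin n => μ)) := by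
          refine lintegral_mono fun ω => ?_
          rw [← ENNReal.ofReal_mul (by positivity), ← ENNReal.ofReal_add (by positivity) (by positivity)]
          exact ENNReal.ofReal_le_ofReal (pow_split hp1 hbias)
      _ = ENNReal.ofReal (2 ^ p) * ∫⁻ ω, ENNReal.ofReal (|(n:ℝ)⁻¹ * ∑ i, dirKb d b s (ω i) - e| ^ p) ∂(Measure.pi (fun _ : Fin n => μ)) +
            ENNReal.ofReal (2 ^ p * (Cbias d M * b ^ (β / 2)) ^ p) := by
          rw [lintegral_add_right _ measurable_const, lintegral_const_mul _ hmT]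
          simp
      _ ≤ ENNReal.ofReal (2 ^ p) * ENNReal.ofReal (5 * M ^ 2 * (Csup d ^ (p/2) * W ^ (p/2) * psi d s ^ (p/2) +
            if p ≤ 2 then 0 else Csup d ^ (p-1) * W ^ (p-1) * psi d s ^ (p-1))) +
            ENNReal.ofReal (2 ^ p * (Cbias d M * b ^ (β / 2)) ^ p) := by
          gcongr
      _ = _ := by
          have hite : (if p ≤ 2 then 0 else Csup d ^ (p-1) * W ^ (p-1) * psi d s ^ (p-1)) =
              Csup d ^ (p-1) * Q * psi d s ^ (p-1) := by
            rw [hQ]; split_ifs <;> ring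
          rw [hite, ← ENNReal.ofReal_mul (by positivity), ← ENNReal.ofReal_mul (by positivity),
            ← ENNReal.ofReal_mul (by positivity), ← ENNReal.ofReal_add (by positivity) (by positivity),
            ← ENNReal.ofReal_add (by positivity) (by positivity),
            ← ENNReal.ofReal_add (by positivity) (by positivity), Real.mul_rpow hCb (by positivity)]
          congr 1
          ring
  have hred := risk_reduction (n := n) (b := b) (p := p) hb hf0 hFf hFae hFm hF0 hFi
  have hmp : ∀ r : ℝ, Measurable (fun s => ENNReal.ofReal (psi d s ^ r)) := fun r =>
    ((measurable_psi d).pow_const r).ennreal_ofReal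
  have hfinal : ENNReal.ofReal (lpRiskPow d n b p f) ≤
      ENNReal.ofReal ((D1 + D2 + D3) * (W ^ (p / 2) + Q + (b ^ (β / 2)) ^ p)) := by
    refine hred.trans ?_
    calc _ ≤ ∫⁻ s in So d 1, (ENNReal.ofReal (2 ^ p * (5 * M ^ 2 * Csup d ^ (p / 2)) * W ^ (p / 2)) * ENNReal.ofReal (psi d s ^ (p / 2)) +
            ENNReal.ofReal (2 ^ p * (5 * M ^ 2 * Csup d ^ (p - 1)) * Q) * ENNReal.ofReal (psi d s ^ (p - 1)) +
            ENNReal.ofReal (2 ^ p * Cbias d M ^ p * (b ^ (β / 2)) ^ p)) :=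
          setLIntegral_mono' (measurableSet_So d 1) key
      _ = ENNReal.ofReal (2 ^ p * (5 * M ^ 2 * Csup d ^ (p / 2)) * W ^ (p / 2)) * (∫⁻ s in So d 1, ENNReal.ofReal (psi d s ^ (p / 2))) +
            ENNReal.ofReal (2 ^ p * (5 * M ^ 2 * Csup d ^ (p - 1)) * Q) * (∫⁻ s in So d 1, ENNReal.ofReal (psi d s ^ (p - 1))) +
            ENNReal.ofReal (2 ^ p * Cbias d M ^ p * (b ^ (β / 2)) ^ p) * volume (So d 1) := by
          rw [lintegral_add_right _ measurable_const, lintegral_add_right _ ((hmp _).const_mul _),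
            lintegral_const_mul _ (hmp _), lintegral_const_mul _ (hmp _), setLIntegral_const]
      _ ≤ ENNReal.ofReal (2 ^ p * (5 * M ^ 2 * Csup d ^ (p / 2)) * W ^ (p / 2)) * ENNReal.ofReal C1 +
            ENNReal.ofReal (2 ^ p * (5 * M ^ 2 * Csup d ^ (p - 1)) * Q) * ENNReal.ofReal C2 +
            ENNReal.ofReal (2 ^ p * Cbias d M ^ p * (b ^ (β / 2)) ^ p) * ENNReal.ofReal V := by
          gcongr
          rw [hV, ENNReal.ofReal_toReal hVfin]
      _ = ENNReal.ofReal (D1 * W ^ (p / 2) + D2 * Q + D3 * (b ^ (β / 2)) ^ p) := by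
          rw [← ENNReal.ofReal_mul (by positivity), ← ENNReal.ofReal_mul (by positivity),
            ← ENNReal.ofReal_mul (by positivity), ← ENNReal.ofReal_add (by positivity) (by positivity),
            ← ENNReal.ofReal_add (by positivity) (by positivity)]
          congr 1
          rw [hD1, hD2, hD3]; ring
      _ ≤ _ := by
          refine ENNReal.ofReal_le_ofReal ?_
          have a1 : 0 ≤ W ^ (p/2) := by positivity
          have a3 : 0 ≤ (b ^ (β / 2)) ^ p := by positivity
          nlinarith [mul_nonneg hD1' hQ0, mul_nonneg hD1' a3, mul_nonneg hD2' a1, mul_nonneg hD2' a3,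
            mul_nonneg hD3' a1, mul_nonneg hD3' hQ0]
  exact (ENNReal.ofReal_le_ofReal_iff (by positivity)).1 hfinal

/-- Proposition 2.1: for `p ∈ [1,3)`, `β ∈ (0,2]` and bandwidths
`b_n = c n^{-2/(d+2β)}`, the Dirichlet kernel density estimator achieves the minimax rate
`n^{-β/(d+2β)}` on `Σ(d,β,L)` under the `L^p` loss. -/
theorem dirichlet_minimax (d : ℕ) (hd : 1 ≤ d) (p β L c : ℝ)
    (hp1 : 1 ≤ p) (hp2 : p < 3) (hβ1 : 0 < β) (hβ2 : β ≤ 2) (hL : 0 < L) (hc : 0 < c) :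
    Filter.limsup
      (fun n : ℕ =>
        (⨆ f ∈ holderClass d β L,
            ENNReal.ofReal
              ((lpRiskPow d n (c * (n : ℝ) ^ (-2 / ((d : ℝ) + 2 * β))) p f) ^ (1 / p))) /
          ENNReal.ofReal ((n : ℝ) ^ (-β / ((d : ℝ) + 2 * β))))
      Filter.atTop < ⊤ := by
  obtain ⟨C, hC, hrisk⟩ := risk_bound d hβ1 hβ2 hL hp1 hp2
  set D : ℝ := (d : ℝ) + 2 * β with hD
  have hD0 : 0 < D := by positivity
  set K : ℝ := (c ^ (-(d:ℝ)/2)) ^ (p / 2) + (c ^ (-(d:ℝ)/2)) ^ (p - 1) + (c ^ (β / 2)) ^ p with hK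
  have hK0 : 0 < K := by positivity
  have htend : Tendsto (fun n : ℕ => c * (n : ℝ) ^ (-2 / D)) atTop (𝓝 0) := by
    have h1 : Tendsto (fun x : ℝ => x ^ (-(2 / D))) atTop (𝓝 0) := tendsto_rpow_neg_atTop (by positivity)
    have h2 := (h1.comp tendsto_natCast_atTop_atTop).const_mul c
    rw [mul_zero] at h2
    refine h2.congr fun n => ?_
    simp [neg_div]
  have hev : ∀ᶠ n : ℕ in atTop, c * (n : ℝ) ^ (-2 / D) ≤ 1 :=
    (htend.eventually (gt_mem_nhds zero_lt_one)).mono fun n h => le_of_lt h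
  refine lt_of_le_of_lt (limsup_le_of_le (a := ENNReal.ofReal ((C * K) ^ (1 / p))) (by isBoundedDefault) ?_)
    ENNReal.ofReal_lt_top
  filter_upwards [hev, eventually_ge_atTop 1] with n hb1 hn
  have hN : (1:ℝ) ≤ n := by exact_mod_cast hn
  have hN0 : (0:ℝ) < n := by linarith
  set ρ : ℝ := (n : ℝ) ^ (-β / D) with hρ
  have hρ0 : 0 < ρ := by positivity
  have hρ1 : ρ ≤ 1 := Real.rpow_le_one_of_one_le_of_nonpos hN
    (div_nonpos_of_nonpos_of_nonneg (by linarith) hD0.le)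
  set b : ℝ := c * (n : ℝ) ^ (-2 / D) with hb
  have hb0 : 0 < b := by positivity
  have eW : b ^ (-(d:ℝ)/2) / n = c ^ (-(d:ℝ)/2) * ρ ^ (2:ℝ) := by
    rw [hb, Real.mul_rpow hc.le (by positivity), ← Real.rpow_mul hN0.le, mul_div_assoc,
      ← Real.rpow_sub_one hN0.ne', hρ, ← Real.rpow_mul hN0.le]
    congr 2
    rw [hD] at hD0 ⊢
    field_simp
    ring
  have eB : b ^ (β / 2) = c ^ (β / 2) * ρ := by
    rw [hb, Real.mul_rpow hc.le (by positivity), ← Real.rpow_mul hN0.le, hρ]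
    congr 2
    field_simp
  have hbd : ∀ f ∈ holderClass d β L, lpRiskPow d n b p f ≤ C * K * ρ ^ p := by
    intro f hf
    refine (hrisk f hf n hn b hb0 hb1).trans ?_
    rw [mul_assoc]
    refine mul_le_mul_of_nonneg_left ?_ hC
    rw [eW, eB, Real.mul_rpow (by positivity) (by positivity), Real.mul_rpow (by positivity) (by positivity),
      Real.mul_rpow (by positivity) (by positivity), ← Real.rpow_mul hρ0.le, ← Real.rpow_mul hρ0.le]
    have e1 : (2:ℝ) * (p / 2) = p := by ring
    rw [e1, hK, add_mul, add_mul]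
    gcongr
    split_ifs with h
    · positivity
    · push Not at h
      gcongr ?_ * ?_
      exact Real.rpow_le_rpow_of_exponent_ge hρ0 hρ1 (by linarith)
  have hp0 : p ≠ 0 := by linarith
  refine ENNReal.div_le_of_le_mul ?_
  rw [← ENNReal.ofReal_mul (by positivity)]
  refine iSup₂_le fun f hf => ENNReal.ofReal_le_ofReal ?_
  have hr0 : 0 ≤ lpRiskPow d n b p f :=
    integral_nonneg fun ω => mul_nonneg (Finset.prod_nonneg fun i _ => hf.1 _)
      (integral_nonneg fun s => by positivity)
  calc lpRiskPow d n b p f ^ (1 / p) ≤ (C * K * ρ ^ p) ^ (1 / p) :=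
        Real.rpow_le_rpow hr0 (hbd f hf) (by positivity)
    _ = (C * K) ^ (1 / p) * ρ := by
        rw [Real.mul_rpow (by positivity) (by positivity), ← Real.rpow_mul hρ0.le, mul_one_div_cancel hp0,
          Real.rpow_one]
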